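/- arXiv:1804.03736 — 3 statements merged into one kernel-verified Lean document; each statement's English description precedes it below -/
import Mathlib

section
/- Let X be a complete Hausdorff semitopological semilattice satisfying at least one of the following conditions: (1) the map (x,y) ↦ x∧y is jointly continuous; (2) X is a sequential space; (3) X admits an injective continuous map to a T2δ-space; (4) X is functionally Hausdorff. Then every Scott-open subset U of X is open in X. -/
open Set TopologicalSpace

variable (X : Type*)

/-- The weak• topology `𝒵_X` of a topologized semilattice: generated by the subbase of
complements of closed subsemilattices. -/
def zarTop [SemilatticeInf X] [TopologicalSpace X] : TopologicalSpace X :=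
  TopologicalSpace.generateFrom
    {U : Set X | ∃ S : Set X, IsClosed S ∧ (∀ a ∈ S, ∀ b ∈ S, a ⊓ b ∈ S) ∧ U = Sᶜ}

/-- The weak° topology `η_X` of a topologized semilattice: generated by the base of
open subsemilattices. -/
def etaTop [SemilatticeInf X] [TopologicalSpace X] : TopologicalSpace X :=
  TopologicalSpace.generateFrom
    {U : Set X | IsOpen U ∧ ∀ a ∈ U, ∀ b ∈ U, a ⊓ b ∈ U}

/-- The `𝕀`-weak topology `𝒲_X`: generated by the subbase of preimages of open subsets of
`[0,1]` under continuous homomorphisms `h : X → ([0,1], min)`. -/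
def iweakTop [SemilatticeInf X] [TopologicalSpace X] : TopologicalSpace X :=
  TopologicalSpace.generateFrom
    {V : Set X | ∃ h : X → unitInterval, Continuous h ∧
      (∀ x y : X, h (x ⊓ y) = min (h x) (h y)) ∧
      ∃ U : Set unitInterval, IsOpen U ∧ V = h ⁻¹' U}

/-- `U` is Scott-open: `U = ↑U` and every nonempty up-directed set whose supremum lies in
`U` meets `U`. -/
def ScottOpen [Preorder X] (U : Set X) : Prop :=
  IsUpperSet U ∧ ∀ D : Set X, D.Nonempty → DirectedOn (· ≤ ·) D →
    ∀ a : X, IsLUB D a → a ∈ U → (D ∩ U).Nonempty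

/-- The Lawson topology `Λ_X`: generated by the subbase consisting of Scott-open sets and
complements of upper sets `↑x`. -/
def lawsonTop [Preorder X] : TopologicalSpace X :=
  TopologicalSpace.generateFrom
    ({U : Set X | ScottOpen X U} ∪ {V : Set X | ∃ x : X, V = (Set.Ici x)ᶜ})

/-- The interval topology: generated by the subbase of complements of the sets `↑x`, `↓x`. -/
def intervalTop [Preorder X] : TopologicalSpace X :=
  TopologicalSpace.generateFrom
    ({V : Set X | ∃ x : X, V = (Set.Ici x)ᶜ} ∪ {V : Set X | ∃ x : X, V = (Set.Iic x)ᶜ})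

/-- A topologized semilattice is complete if every nonempty chain `C` has an infimum and a
supremum in `X`, both belonging to the closure of `C`. -/
def CompleteTS [SemilatticeInf X] [TopologicalSpace X] : Prop :=
  ∀ C : Set X, C.Nonempty → IsChain (· ≤ ·) C →
    (∃ a : X, IsGLB C a ∧ a ∈ closure C) ∧ (∃ b : X, IsLUB C b ∧ b ∈ closure C)

/-- A T2δ-space: a T1 space in which every point of an open set `U` has a countable family
of closed neighborhoods whose intersection is contained in `U`. -/
def T2DeltaSpace (Y : Type*) [TopologicalSpace Y] : Prop :=
  T1Space Y ∧ ∀ U : Set Y, IsOpen U → ∀ y ∈ U,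
    ∃ 𝒰 : Set (Set Y), 𝒰.Countable ∧ (∀ A ∈ 𝒰, IsClosed A ∧ A ∈ nhds y) ∧ ⋂₀ 𝒰 ⊆ U

universe u

open Filter Topology

open scoped Cardinal

/-- A set is chain-closed if it contains the suprema of its nonempty chains. -/
def ChainSupClosed {P : Type*} [Preorder P] (F : Set P) : Prop :=
  ∀ C ⊆ F, C.Nonempty → IsChain (· ≤ ·) C → ∀ b, IsLUB C b → b ∈ F

theorem ScottOpen.chainSupClosed_compl {P : Type*} [Preorder P] {U : Set P}
    (hU : ScottOpen P U) : ChainSupClosed Uᶜ := by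
  intro C hCU hC hchain b hb hbU
  obtain ⟨c, hc, hcU⟩ := hU.2 C hC hchain.directedOn b hb hbU
  exact hCU hc hcU

theorem ChainSupClosed.inter_Iic {P : Type*} [Preorder P] {F : Set P}
    (hF : ChainSupClosed F) (x : P) : ChainSupClosed (F ∩ Iic x) :=
  fun C hC hne hchain b hb =>
    ⟨hF C (fun _ hc => (hC hc).1) hne hchain b hb, hb.2 fun _ hc => (hC hc).2⟩

section Complete

variable {X : Type*} [SemilatticeInf X] [TopologicalSpace X]

theorem CompleteTS.exists_isLUB_mem (hcomp : CompleteTS X) {C : Set X} (hne : C.Nonempty)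
    (hC : IsChain (· ≤ ·) C) : ∃ b, IsLUB C b ∧ ∀ S, IsClosed S → C ⊆ S → b ∈ S := by
  obtain ⟨b, hb, hbC⟩ := (hcomp C hne hC).2
  exact ⟨b, hb, fun S hS hCS => closure_minimal hCS hS hbC⟩

/-- In a complete topologized semilattice every closed set is chain-closed. -/
theorem CompleteTS.chainSupClosed (hcomp : CompleteTS X) {S : Set X} (hS : IsClosed S) :
    ChainSupClosed S := by
  intro C hCS hne hC b hb
  obtain ⟨b', hb', h⟩ := hcomp.exists_isLUB_mem hne hC
  exact hb.unique hb' ▸ h S hS hCS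

/-- A nonempty closed subsemilattice of a complete topologized semilattice has a least element. -/
theorem CompleteTS.exists_isLeast (hcomp : CompleteTS X) {S : Set X} (hS : IsClosed S)
    (hinf : InfClosed S) (hne : S.Nonempty) : ∃ m, IsLeast S m := by
  obtain ⟨s, hs⟩ := hne
  obtain ⟨m, -, hm⟩ := @zorn_le_nonempty₀ Xᵒᵈ _ (OrderDual.ofDual ⁻¹' S) (by
    intro c hc hchain y hy
    obtain ⟨a, ha, hac⟩ := (hcomp (OrderDual.toDual ⁻¹' c) ⟨_, hy⟩ hchain.symm).1
    exact ⟨OrderDual.toDual a, closure_minimal (fun z hz => hc hz) hS hac,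
      fun z hz => ha.1 (show OrderDual.ofDual z ∈ OrderDual.toDual ⁻¹' c from hz)⟩) (OrderDual.toDual s) hs
  refine ⟨OrderDual.ofDual m, hm.1, fun z hz => ?_⟩
  have := hm.2 (y := OrderDual.toDual (OrderDual.ofDual m ⊓ z)) (hinf hm.1 hz) inf_le_left
  exact le_trans (show OrderDual.ofDual m ≤ OrderDual.ofDual m ⊓ z from this) inf_le_right

/-- In a semitopological semilattice the closure of a subsemilattice is a subsemilattice. -/
theorem InfClosed.closure_of_continuous_inf (hsemi : ∀ a : X, Continuous fun x => a ⊓ x)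
    {S : Set X} (hS : InfClosed S) : InfClosed (closure S) := by
  intro a ha b hb
  refine map_mem_closure₂' (f := fun a b : X => a ⊓ b) hsemi ?_ ha hb
    fun a ha b hb => hS ha hb
  intro b
  simpa only [inf_comm] using hsemi b

/-- Given an antitone family of closed subsemilattices meeting a chain-closed lower set `F`,
the supremum of their least elements lies in `F` and in each of them. -/
theorem exists_isLUB_least_of_antitone (hcomp : CompleteTS X) {F : Set X} (hF : IsLowerSet F)
    (hFc : ChainSupClosed F) {ι : Type*} [LinearOrder ι] [Nonempty ι] {K : ι → Set X}
    (hK : Antitone K) (hKc : ∀ i, IsClosed (K i)) (hKi : ∀ i, InfClosed (K i))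
    (hKF : ∀ i, (F ∩ K i).Nonempty) :
    ∃ p ∈ F, (∀ i, p ∈ K i) ∧ IsLUB {m | ∃ i, IsLeast (K i) m} p := by
  choose m hm using fun i =>
    hcomp.exists_isLeast (hKc i) (hKi i) ((hKF i).mono inter_subset_right)
  have hmono : Monotone m := fun i j hij => (hm i).2 (hK hij (hm j).1)
  have hmF : ∀ i, m i ∈ F := fun i => by
    obtain ⟨z, hzF, hz⟩ := hKF i
    exact hF ((hm i).2 hz) hzF
  have hset : {m | ∃ i, IsLeast (K i) m} = range m := by
    ext z
    constructor
    · rintro ⟨i, hi⟩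
      exact ⟨i, (hm i).unique hi⟩
    · rintro ⟨i, rfl⟩
      exact ⟨i, hm i⟩
  obtain ⟨p, hp, -⟩ := hcomp.exists_isLUB_mem (range_nonempty m) hmono.isChain_range
  refine ⟨p, hFc _ (range_subset_iff.2 hmF) (range_nonempty m) hmono.isChain_range p hp,
    fun i => ?_, hset ▸ hp⟩
  refine hcomp.chainSupClosed (hKc i) (m '' Ici i) ?_ ⟨_, i, le_rfl, rfl⟩
    (hmono.isChain_range.mono (image_subset_range _ _)) p ⟨?_, ?_⟩
  · rintro _ ⟨j, hj, rfl⟩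
    exact hK hj (hm j).1
  · rintro _ ⟨j, -, rfl⟩
    exact hp.1 ⟨j, rfl⟩
  · refine fun b hb => hp.2 ?_
    rintro _ ⟨j, rfl⟩
    exact (hmono (le_max_right i j)).trans (hb ⟨_, le_max_left i j, rfl⟩)

end Complete

/-- Well-founded recursion for a predicate depending only on the earlier values. -/
theorem exists_forall_of_wellFoundedLT {ι X : Type*} [Nonempty X] [LinearOrder ι]
    [WellFoundedLT ι] (P : ι → (ι → X) → X → Prop)
    (hcongr : ∀ i f g, (∀ j < i, f j = g j) → ∀ z, P i f z → P i g z)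
    (hex : ∀ i f, ∃ z, P i f z) : ∃ y : ι → X, ∀ i, P i y (y i) := by
  classical
  choose c hc using hex
  let y : ι → X := (wellFounded_lt (α := ι)).fix fun i ih =>
    c i fun j => if h : j < i then ih j h else Classical.arbitrary X
  refine ⟨y, fun i => ?_⟩
  have hy : y i = c i fun j => if j < i then y j else Classical.arbitrary X := by
    simp only [y]
    rw [WellFounded.fix_eq]
    simp only [dite_eq_ite]
  rw [hy]
  exact hcongr i _ _ (fun j hj => if_pos hj) _ (hc i _)

section Fold

variable {X ι : Type*} [SemilatticeInf X]

/-- The infimum of `x` and of the values of `y` on the finite set `E`. -/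
def finiteInf (x : X) (y : ι → X) (E : Finset ι) : X :=
  E.fold (fun a b : X => a ⊓ b) x y

@[simp]
theorem finiteInf_empty (x : X) (y : ι → X) : finiteInf x y ∅ = x := rfl

theorem finiteInf_insert [DecidableEq ι] (x : X) (y : ι → X) (i : ι) (E : Finset ι) :
    finiteInf x y (insert i E) = y i ⊓ finiteInf x y E :=
  Finset.fold_insert_idem

theorem finiteInf_singleton (x : X) (y : ι → X) (i : ι) : finiteInf x y {i} = y i ⊓ x :=
  Finset.fold_singleton

theorem finiteInf_congr {x : X} {y z : ι → X} {E : Finset ι} (h : ∀ i ∈ E, y i = z i) :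
    finiteInf x y E = finiteInf x z E :=
  Finset.fold_congr h

theorem finiteInf_le (x : X) (y : ι → X) (E : Finset ι) : finiteInf x y E ≤ x := by
  classical
  induction E using Finset.induction_on with
  | empty => simp
  | insert i s _ ih => rw [finiteInf_insert]; exact inf_le_right.trans ih

theorem finiteInf_union [DecidableEq ι] (x : X) (y : ι → X) (E E' : Finset ι) :
    finiteInf x y (E ∪ E') = finiteInf x y E ⊓ finiteInf x y E' := by
  induction E using Finset.induction_on with
  | empty => simp [inf_eq_right.2 (finiteInf_le x y E')]
  | insert i s _ ih => rw [Finset.insert_union, finiteInf_insert, ih, finiteInf_insert, inf_assoc]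

end Fold

/-- Recursive construction of a transfinite sequence whose tails generate subsemilattices
contained in prescribed neighborhoods of `x`. -/
theorem exists_seq_infClosure_subset {X ι : Type*} [SemilatticeInf X] [TopologicalSpace X]
    (hsemi : ∀ a : X, Continuous fun x => a ⊓ x) [LinearOrder ι] [WellFoundedLT ι] {x : X}
    {V H : ι → Set X} (hV : ∀ i, IsOpen (V i)) (hxV : ∀ i, x ∈ V i) (hH : ∀ i, H i ⊆ Iic x)
    (hmeet : ∀ i : ι, ∀ O : Finset (Iio i) × Iio i → Set X, (∀ j, IsOpen (O j)) → (∀ j, x ∈ O j) →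
      (H i ∩ ⋂ j, O j).Nonempty) :
    ∃ y : ι → X, (∀ i, y i ∈ H i) ∧ ∀ i, infClosure (y '' Ioi i) ⊆ V i := by
  classical
  have : Nonempty X := ⟨x⟩
  obtain ⟨y, hy⟩ := exists_forall_of_wellFoundedLT
    (fun i (f : ι → X) z => z ∈ H i ∧ ∀ E : Finset ι, ↑E ⊆ Iio i → ∀ j < i,
      finiteInf x f E ∈ V j → finiteInf x f E ⊓ z ∈ V j)
    (by
      rintro i f g hfg z ⟨hz, h⟩
      refine ⟨hz, fun E hE j hj => ?_⟩
      rw [← finiteInf_congr fun k hk => hfg k (hE hk)]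
      exact h E hE j hj)
    (by
      intro i f
      obtain ⟨z, hzH, hz⟩ := hmeet i
        (fun e => {z | finiteInf x f (e.1.map (.subtype _)) ∈ V e.2 →
          finiteInf x f (e.1.map (.subtype _)) ⊓ z ∈ V e.2})
        (fun e => by
          by_cases h : finiteInf x f (e.1.map (.subtype _)) ∈ V e.2
          · simp only [h, forall_const]
            exact (hV e.2).preimage (hsemi _)
          · simp only [h, false_imp_iff, ofPred_true, isOpen_univ])
        (fun e h => by
          rwa [inf_eq_left.2 (finiteInf_le _ _ _)])
      refine ⟨z, hzH, fun E hE j hj => ?_⟩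
      have hmap : (E.subtype (· ∈ Iio i)).map (.subtype _) = E :=
        Finset.subtype_map_of_mem fun k hk => hE hk
      have := mem_iInter.1 hz (E.subtype (· ∈ Iio i), ⟨j, hj⟩)
      simpa only [mem_ofPred_eq, hmap] using this)
  refine ⟨y, fun i => (hy i).1, fun i => ?_⟩
  have hfold : ∀ E : Finset ι, ↑E ⊆ Ioi i → finiteInf x y E ∈ V i := by
    intro E
    induction E using Finset.induction_on_max with
    | empty => exact fun _ => hxV i
    | insert a s has ih =>
      intro hs
      rw [Finset.coe_insert, insert_subset_iff] at hs
      rw [finiteInf_insert, inf_comm]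
      exact (hy a).2 s has i hs.1 (ih hs.2)
  refine (infClosure_min (t := {z | ∃ E : Finset ι, ↑E ⊆ Ioi i ∧ finiteInf x y E = z})
    ?_ ?_).trans ?_
  · rintro _ ⟨j, hj, rfl⟩
    exact ⟨{j}, by simpa using hj, by simpa [finiteInf_singleton] using hH j (hy j).1⟩
  · rintro _ ⟨E, hE, rfl⟩ _ ⟨E', hE', rfl⟩
    exact ⟨E ∪ E', by simp [hE, hE'], finiteInf_union x y E E'⟩
  · rintro _ ⟨E, hE, rfl⟩
    exact hfold E hE

theorem inter_iInter_nonempty_of_finite {X : Type*} [TopologicalSpace X] {F : Set X} {x : X} (hx : x ∈ closure F) {J : Type*}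
    [Finite J] {O : J → Set X} (hO : ∀ j, IsOpen (O j)) (hxO : ∀ j, x ∈ O j) :
    (F ∩ ⋂ j, O j).Nonempty := by
  rw [inter_comm]
  exact mem_closure_iff.1 hx _ (isOpen_iInter_of_finite hO) (mem_iInter.2 hxO)

section Limit

variable {X : Type*} [SemilatticeInf X] [TopologicalSpace X]

theorem exists_mem_forall_mem_closure (hsemi : ∀ a : X, Continuous fun x => a ⊓ x)
    (hcomp : CompleteTS X) {F : Set X} (hF : IsLowerSet F) (hFc : ChainSupClosed F)
    {ι : Type*} [LinearOrder ι] [WellFoundedLT ι] [NoMaxOrder ι] [Nonempty ι] {x : X}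
    (hFx : F ⊆ Iic x) {V : ι → Set X} (hV : ∀ i, IsOpen (V i)) (hxV : ∀ i, x ∈ V i)
    (hmeet : ∀ i : ι, ∀ O : Finset (Iio i) × Iio i → Set X, (∀ j, IsOpen (O j)) → (∀ j, x ∈ O j) →
      (F ∩ ⋂ j, O j).Nonempty) :
    ∃ p ∈ F, ∀ i, p ∈ closure (V i) := by
  obtain ⟨y, hyF, hyV⟩ := exists_seq_infClosure_subset hsemi hV hxV (fun _ => hFx) hmeet
  obtain ⟨p, hpF, hp, -⟩ := exists_isLUB_least_of_antitone hcomp hF hFc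
    (K := fun i : ι => closure (infClosure (y '' Ioi i)))
    (fun i j hij => closure_mono (infClosure_mono (image_mono (f := y) (Ioi_subset_Ioi hij))))
    (fun i => isClosed_closure)
    (fun i => infClosed_infClosure.closure_of_continuous_inf hsemi)
    (fun i => by
      obtain ⟨j, hj⟩ := exists_gt i
      exact ⟨y j, hyF j, subset_closure (subset_infClosure ⟨j, hj, rfl⟩)⟩)
  exact ⟨p, hpF, fun i => closure_mono (hyV i) (hp i)⟩

theorem exists_mem_forall_nat_mem_closure (hsemi : ∀ a : X, Continuous fun x => a ⊓ x)
    (hcomp : CompleteTS X) {F : Set X} (hF : IsLowerSet F) (hFc : ChainSupClosed F) {x : X}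
    (hFx : F ⊆ Iic x) (hx : x ∈ closure F) {V : ℕ → Set X} (hV : ∀ n, IsOpen (V n))
    (hxV : ∀ n, x ∈ V n) : ∃ p ∈ F, ∀ n, p ∈ closure (V n) :=
  exists_mem_forall_mem_closure hsemi hcomp hF hFc hFx hV hxV fun _ _ hO hxO =>
    inter_iInter_nonempty_of_finite hx hO hxO

end Limit

theorem mk_Iio_ord_toType_lt {κ : Cardinal} (i : κ.ord.ToType) : #(Iio i) < κ :=
  (Cardinal.mk_Iio_lt i (by simp)).trans_eq (Cardinal.mk_ord_toType κ)

theorem Cardinal.mk_finset_prod_lt {α : Type*} {κ : Cardinal} (hκ : ℵ₀ ≤ κ) (hα : #α < κ) :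
    #(Finset α × α) < κ := by
  rcases finite_or_infinite α with h | h
  · exact (Cardinal.lt_aleph0_of_finite _).trans_le hκ
  · rwa [Cardinal.mk_prod, Cardinal.lift_id, Cardinal.lift_id, Cardinal.mk_finset_of_infinite,
      Cardinal.mul_eq_self (Cardinal.aleph0_le_mk α)]

/-- A chain-closed lower set meeting all finite intersections of a family of closed
subsemilattices meets the intersection of the whole family. -/
theorem inter_iInter_nonempty_of_infClosed {X : Type*} [SemilatticeInf X] [TopologicalSpace X]
    (hcomp : CompleteTS X) {F : Set X} (hF : IsLowerSet F) (hFc : ChainSupClosed F)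
    {J : Type*} (S : J → Set X) (hSc : ∀ j, IsClosed (S j)) (hSi : ∀ j, InfClosed (S j))
    (hfin : ∀ t : Set J, t.Finite → (F ∩ ⋂ j ∈ t, S j).Nonempty) :
    (F ∩ ⋂ j, S j).Nonempty := by
  suffices H : ∀ κ : Cardinal, ∀ t : Set J, #t = κ → (F ∩ ⋂ j ∈ t, S j).Nonempty by
    simpa using H _ univ rfl
  intro κ
  induction κ using WellFoundedLT.induction with
  | ind κ ih =>
  intro t ht
  rcases lt_or_ge κ ℵ₀ with hκ | hκ
  · exact hfin t (Cardinal.lt_aleph0_iff_set_finite.1 (ht ▸ hκ))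
  have := Cardinal.noMaxOrder hκ
  obtain ⟨e⟩ : Nonempty (κ.ord.ToType ≃ t) := Cardinal.eq.1 (by rw [Cardinal.mk_ord_toType, ht])
  have : Nonempty κ.ord.ToType := by
    rw [← Cardinal.mk_ne_zero_iff, Cardinal.mk_ord_toType]
    exact (Cardinal.aleph0_pos.trans_le hκ).ne'
  obtain ⟨p, hpF, hp, -⟩ := exists_isLUB_least_of_antitone hcomp hF hFc
    (K := fun i : κ.ord.ToType => ⋂ j ∈ (fun i => (e i : J)) '' Iio i, S j)
    (fun i i' hii' => biInter_subset_biInter_left (image_mono (Iio_subset_Iio hii')))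
    (fun i => isClosed_biInter fun j _ => hSc j)
    (fun i a ha b hb => mem_iInter₂.2 fun j hj =>
      hSi j (mem_iInter₂.1 ha j hj) (mem_iInter₂.1 hb j hj))
    (fun i => ih _ (Cardinal.mk_image_le.trans_lt (mk_Iio_ord_toType_lt i)) _ rfl)
  refine ⟨p, hpF, mem_iInter₂.2 fun j hj => ?_⟩
  obtain ⟨i, hi⟩ := exists_gt (e.symm ⟨j, hj⟩)
  exact mem_iInter₂.1 (hp i) j ⟨_, hi, by simp⟩

section Regularity

variable {X : Type u} [SemilatticeInf X] [TopologicalSpace X]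

/-- In a `T2δ` space a countable family of closed neighborhoods can be enumerated. -/
theorem T2DeltaSpace.exists_seq {Y : Type*} [TopologicalSpace Y] (hY : T2DeltaSpace Y)
    {U : Set Y} (hU : IsOpen U) {y : Y} (hy : y ∈ U) :
    ∃ A : ℕ → Set Y, (∀ n, IsClosed (A n) ∧ A n ∈ 𝓝 y) ∧ ⋂ n, A n ⊆ U := by
  obtain ⟨𝒰, hc, hA, hsub⟩ := hY.2 U hU y hy
  obtain ⟨A, hAr⟩ := (hc.insert univ).exists_eq_range (insert_nonempty _ _)
  have hmem : ∀ n, A n ∈ insert univ 𝒰 := fun n => hAr ▸ mem_range_self n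
  refine ⟨A, fun n => ?_, ?_⟩
  · rcases hmem n with h | h
    · rw [h]
      exact ⟨isClosed_univ, univ_mem⟩
    · exact hA _ h
  · rwa [← sInter_range, ← hAr, sInter_insert, univ_inter]

/-- In a `T2δ` semilattice, if `x` is in the closure of a chain-closed lower set `F ⊆ ↓x`, then
`F` meets the intersection of every family of neighborhoods of `x`. -/
theorem T2DeltaSpace.inter_iInter_nonempty (hX : T2DeltaSpace X)
    (hsemi : ∀ a : X, Continuous fun x => a ⊓ x) (hcomp : CompleteTS X) {F : Set X}
    (hF : IsLowerSet F) (hFc : ChainSupClosed F) {x : X} (hFx : F ⊆ Iic x) (hx : x ∈ closure F)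
    {J : Type u} (O : J → Set X) (hO : ∀ j, IsOpen (O j)) (hxO : ∀ j, x ∈ O j) :
    (F ∩ ⋂ j, O j).Nonempty := by
  suffices H : ∀ κ : Cardinal.{u}, ∀ (J : Type u) (O : J → Set X), #J = κ →
      (∀ j, IsOpen (O j)) → (∀ j, x ∈ O j) → (F ∩ ⋂ j, O j).Nonempty from H _ J O rfl hO hxO
  clear! J
  intro κ
  induction κ using WellFoundedLT.induction with
  | ind κ ih =>
  intro J O hJ hO hxO
  rcases lt_or_ge κ ℵ₀ with hκ | hκ
  · have : Finite J := Cardinal.lt_aleph0_iff_finite.1 (hJ ▸ hκ)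
    exact inter_iInter_nonempty_of_finite hx hO hxO
  choose A hA hAO using fun j => hX.exists_seq (hO j) (hxO j)
  have := Cardinal.noMaxOrder hκ
  have : Nonempty κ.ord.ToType := by
    rw [← Cardinal.mk_ne_zero_iff, Cardinal.mk_ord_toType]
    exact (Cardinal.aleph0_pos.trans_le hκ).ne'
  obtain ⟨e⟩ : Nonempty (κ.ord.ToType ≃ J × ℕ) := Cardinal.eq.1 (by
    rw [Cardinal.mk_ord_toType, Cardinal.mk_prod, Cardinal.lift_uzero, Cardinal.mk_nat,
      Cardinal.lift_aleph0, hJ, Cardinal.mul_aleph0_eq hκ])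
  obtain ⟨p, hpF, hp⟩ := exists_mem_forall_mem_closure hsemi hcomp hF hFc (x := x) hFx
    (V := fun i => interior (A (e i).1 (e i).2)) (fun i => isOpen_interior)
    (fun i => mem_interior_iff_mem_nhds.2 (hA _ _).2)
    (fun i O hO hxO => ih _ (Cardinal.mk_finset_prod_lt hκ (mk_Iio_ord_toType_lt i))
      _ O rfl hO hxO)
  refine ⟨p, hpF, mem_iInter.2 fun j => hAO j (mem_iInter.2 fun n => ?_)⟩
  have := hp (e.symm (j, n))
  rw [e.apply_symm_apply] at this
  exact closure_minimal interior_subset (hA j n).1 this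

theorem T2DeltaSpace.mem_of_mem_closure (hX : T2DeltaSpace X)
    (hsemi : ∀ a : X, Continuous fun x => a ⊓ x) (hcomp : CompleteTS X) {F : Set X}
    (hF : IsLowerSet F) (hFc : ChainSupClosed F) {x : X} (hFx : F ⊆ Iic x)
    (hx : x ∈ closure F) : x ∈ F := by
  have := hX.1
  obtain ⟨p, hpF, hp⟩ := hX.inter_iInter_nonempty hsemi hcomp hF hFc hFx hx
    (fun y : {y // y ≠ x} => {y.1}ᶜ) (fun y => isOpen_compl_singleton) (fun y h => y.2 h.symm)
  by_cases h : p = x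
  · exact h ▸ hpF
  · exact absurd rfl (mem_iInter.1 hp ⟨p, h⟩)

/-- The case of a jointly continuous semilattice operation. -/
theorem mem_of_mem_closure_of_continuous_inf [T2Space X]
    (hinf : Continuous fun p : X × X => p.1 ⊓ p.2)
    (hcomp : CompleteTS X) {F : Set X} (hF : IsLowerSet F) (hFc : ChainSupClosed F) {x : X}
    (hFx : F ⊆ Iic x) (hx : x ∈ closure F) : x ∈ F := by
  have hsemi : ∀ a : X, Continuous fun x => a ⊓ x := fun a =>
    hinf.comp (Continuous.prodMk_right a)
  let J := {W : ℕ → Set X // (∀ n, IsOpen (W n)) ∧ (∀ n, x ∈ W n) ∧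
    ∀ n, ∀ a ∈ W (n + 1), ∀ b ∈ W (n + 1), a ⊓ b ∈ W n}
  obtain ⟨p, hpF, hp⟩ := inter_iInter_nonempty_of_infClosed hcomp hF hFc
    (fun W : J => ⋂ n, closure (W.1 n)) (fun W => isClosed_iInter fun n => isClosed_closure)
    (fun W a ha b hb => mem_iInter.2 fun n => map_mem_closure₂ hinf
      (mem_iInter.1 ha (n + 1)) (mem_iInter.1 hb (n + 1)) (W.2.2.2 n))
    (fun t ht => by
      obtain ⟨p, hpF, hp⟩ := exists_mem_forall_nat_mem_closure hsemi hcomp hF hFc hFx hx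
        (V := fun n => ⋂ W ∈ t, W.1 n) (fun n => ht.isOpen_biInter fun W _ => W.2.1 n)
        (fun n => mem_iInter₂.2 fun W _ => W.2.2.1 n)
      exact ⟨p, hpF, mem_iInter₂.2 fun W hW => mem_iInter.2 fun n =>
        closure_mono (biInter_subset_of_mem hW) (hp n)⟩)
  suffices h : p = x from h ▸ hpF
  by_contra hpx
  obtain ⟨V, V', hV, hV', hxV, hpV', hdisj⟩ := t2_separation (Ne.symm hpx)
  have step : ∀ O : {O : Set X // IsOpen O ∧ x ∈ O}, ∃ O' : {O : Set X // IsOpen O ∧ x ∈ O},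
      ∀ a ∈ O'.1, ∀ b ∈ O'.1, a ⊓ b ∈ O.1 := by
    rintro ⟨O, hO, hxO⟩
    obtain ⟨A, B, hA, hB, hxA, hxB, hAB⟩ := isOpen_prod_iff.1 (hO.preimage hinf) x x
      (by simpa using hxO)
    exact ⟨⟨A ∩ B, hA.inter hB, hxA, hxB⟩, fun a ha b hb => hAB (show (a, b) ∈ A ×ˢ B from ⟨ha.1, hb.2⟩)⟩
  choose next hnext using step
  let W : ℕ → {O : Set X // IsOpen O ∧ x ∈ O} := fun n => next^[n] ⟨V, hV, hxV⟩
  have hpW := mem_iInter.1 (mem_iInter.1 hp ⟨fun n => (W n).1, fun n => (W n).2.1,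
    fun n => (W n).2.2, fun n => by
      simp only [W, Function.iterate_succ_apply']
      exact hnext _⟩) 0
  exact (hdisj.closure_left hV').notMem_of_mem_left hpW hpV'

end Regularity

theorem T2DeltaSpace.of_regularSpace {Y : Type*} [TopologicalSpace Y] [T1Space Y]
    [RegularSpace Y] : T2DeltaSpace Y := by
  refine ⟨inferInstance, fun U hU y hy => ?_⟩
  obtain ⟨A, hAy, hA, hAU⟩ := exists_mem_nhds_isClosed_subset (hU.mem_nhds hy)
  exact ⟨{A}, countable_singleton A, by rintro _ rfl; exact ⟨hA, hAy⟩, by simpa using hAU⟩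

theorem T2DeltaSpace.pi {ι : Type*} {Y : ι → Type*} [∀ i, TopologicalSpace (Y i)]
    (hY : ∀ i, T2DeltaSpace (Y i)) : T2DeltaSpace (∀ i, Y i) := by
  have := fun i => (hY i).1
  refine ⟨inferInstance, fun U hU y hy => ?_⟩
  obtain ⟨I, u, hu, huU⟩ := isOpen_pi_iff.1 hU y hy
  choose! A hA hAu using fun i (hi : i ∈ I) => (hY i).exists_seq (hu i hi).1 (hu i hi).2
  refine ⟨⋃ i ∈ I, range fun n => Function.eval i ⁻¹' A i n,
    I.countable_toSet.biUnion fun i _ => countable_range _, ?_, ?_⟩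
  · intro B hB
    obtain ⟨i, hi, n, rfl⟩ := mem_iUnion₂.1 hB
    exact ⟨(hA i hi n).1.preimage (continuous_apply i),
      (continuous_apply i).continuousAt (hA i hi n).2⟩
  · refine fun z hz => huU fun i hi => hAu i hi (mem_iInter.2 fun n => ?_)
    exact hz _ (mem_iUnion₂.2 ⟨i, hi, n, rfl⟩)

theorem T2DeltaSpace.of_isEmbedding {X Y : Type*} [TopologicalSpace X] [TopologicalSpace Y]
    (hY : T2DeltaSpace Y) {f : X → Y} (hf : IsEmbedding f) : T2DeltaSpace X := by
  have := hY.1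
  refine ⟨hf.t1Space, fun U hU x hx => ?_⟩
  obtain ⟨V, hV, rfl⟩ := hf.isInducing.isOpen_iff.1 hU
  obtain ⟨A, hA, hAV⟩ := hY.exists_seq hV hx
  refine ⟨range fun n => f ⁻¹' A n, countable_range _, ?_, ?_⟩
  · rintro _ ⟨n, rfl⟩
    exact ⟨(hA n).1.preimage hf.continuous, hf.continuous.continuousAt (hA n).2⟩
  · rw [sInter_range, ← preimage_iInter]
    exact preimage_mono hAV

/-- The case of a semilattice with a continuous injection into a `T2δ` space: pass to the weaker
`T2δ` semilattice topology induced by the maps `z ↦ f (q ⊓ z)`. -/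
theorem mem_of_mem_closure_of_injective {X Y : Type u} [SemilatticeInf X] [tX : TopologicalSpace X]
    [TopologicalSpace Y] (hY : T2DeltaSpace Y) {f : X → Y} (hfi : Function.Injective f)
    (hfc : Continuous f) (hsemi : ∀ a : X, Continuous fun x => a ⊓ x) (hcomp : CompleteTS X)
    {F : Set X} (hF : IsLowerSet F) (hFc : ChainSupClosed F) {x : X} (hFx : F ⊆ Iic x)
    (hx : x ∈ closure F) : x ∈ F := by
  let g : X → X → Y := fun z q => f (q ⊓ z)
  have hg : Continuous g := continuous_pi fun q => hfc.comp (hsemi q)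
  have hgi : Function.Injective g := fun z w h => by
    have hzw : ∀ q, q ⊓ z = q ⊓ w := fun q => hfi (congrFun h q)
    refine le_antisymm ?_ ?_
    · rw [← inf_eq_left, ← hzw, inf_idem]
    · rw [← inf_eq_left, hzw, inf_idem]
  let t : TopologicalSpace X := .induced g inferInstance
  have hle : tX ≤ t := continuous_iff_le_induced.1 hg
  have hcl : ∀ S : Set X, @closure X tX S ⊆ @closure X t S := fun S => closure.mono hle
  have hemb : @IsEmbedding X (X → Y) t _ g := @IsEmbedding.mk _ _ t _ _ (.induced g) hgi
  refine @T2DeltaSpace.mem_of_mem_closure X _ t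
    (@T2DeltaSpace.of_isEmbedding _ _ t _ (.pi fun _ => hY) g hemb) (fun a => ?_)
    (fun C hne hC => ?_) F hF hFc x hFx (hcl F hx)
  · refine continuous_induced_rng.2 (continuous_pi fun q => ?_)
    have : (fun z => (g ∘ fun x => a ⊓ x) z q) = (fun h : X → Y => h (q ⊓ a)) ∘ g := by
      funext z
      simp only [g, Function.comp_apply, inf_assoc]
    rw [this]
    exact (continuous_apply (q ⊓ a)).comp continuous_induced_dom
  · obtain ⟨⟨a, ha, hac⟩, b, hb, hbc⟩ := hcomp C hne hC
    exact ⟨⟨a, ha, hcl C hac⟩, b, hb, hcl C hbc⟩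

section Sequential

variable {X : Type*} [TopologicalSpace X]

/-- Sequential spaces are countably tight. -/
theorem SequentialSpace.exists_countable_subset_mem_closure [SequentialSpace X] {A : Set X}
    {s : X} (hs : s ∈ closure A) : ∃ B ⊆ A, B.Countable ∧ s ∈ closure B := by
  let T : Set X := {s | ∃ B ⊆ A, B.Countable ∧ s ∈ closure B}
  have hT : IsClosed T := by
    refine IsSeqClosed.isClosed fun u p hu hup => ?_
    choose B hBA hB huB using hu
    refine ⟨⋃ n, B n, iUnion_subset hBA, countable_iUnion hB, ?_⟩
    exact isClosed_closure.mem_of_tendsto hup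
      (.of_forall fun n => closure_mono (subset_iUnion B n) (huB n))
  exact closure_minimal (fun a ha => show a ∈ T from
    ⟨{a}, singleton_subset_iff.2 ha, countable_singleton a, subset_closure rfl⟩) hT hs

variable [SemilatticeInf X]

/-- A countably generated filter on `F` has a lower limit, lying in `F` and in all closed
subsemilattices generated by members of the filter. -/
theorem exists_liminf (hsemi : ∀ a : X, Continuous fun x => a ⊓ x) (hcomp : CompleteTS X)
    {F : Set X} (hF : IsLowerSet F) (hFc : ChainSupClosed F) (𝒢 : Filter X) [𝒢.NeBot]
    [𝒢.IsCountablyGenerated] (hFG : F ∈ 𝒢) :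
    ∃ l ∈ F, (∀ G ∈ 𝒢, l ∈ closure (infClosure G)) ∧
      IsLUB {m | ∃ G ∈ 𝒢, IsLeast (closure (infClosure G)) m} l := by
  obtain ⟨G, hG⟩ := 𝒢.exists_antitone_basis
  have hanti : ∀ {A B : Set X}, A ⊆ B → closure (infClosure A) ⊆ closure (infClosure B) :=
    fun h => closure_mono (infClosure_mono h)
  obtain ⟨l, hlF, hl, hlub⟩ := exists_isLUB_least_of_antitone hcomp hF hFc
    (K := fun n => closure (infClosure (G n))) (fun m n hmn => hanti (hG.antitone hmn))
    (fun n => isClosed_closure)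
    (fun n => infClosed_infClosure.closure_of_continuous_inf hsemi)
    (fun n => by
      obtain ⟨z, hz⟩ := 𝒢.nonempty_of_mem (inter_mem hFG (hG.mem n))
      exact ⟨z, hz.1, subset_closure (subset_infClosure hz.2)⟩)
  refine ⟨l, hlF, fun A hA => ?_, ?_, fun b hb => hlub.2 ?_⟩
  · obtain ⟨n, hn⟩ := hG.mem_iff.1 hA
    exact hanti hn (hl n)
  · rintro m ⟨A, hA, hm⟩
    obtain ⟨n, hn⟩ := hG.mem_iff.1 hA
    exact hm.2 (hanti hn (hl n))
  · rintro m ⟨n, hm⟩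
    exact hb ⟨G n, hG.mem n, hm⟩

/-- The case of a sequential space. -/
theorem mem_of_tendsto_of_sequentialSpace [T2Space X] [SequentialSpace X]
    (hsemi : ∀ a : X, Continuous fun x => a ⊓ x) (hcomp : CompleteTS X) {F : Set X}
    (hF : IsLowerSet F) (hFc : ChainSupClosed F) {x : X} (hFx : F ⊆ Iic x) {u : ℕ → X}
    (hu : ∀ n, u n ∈ F) (hux : Tendsto u atTop (𝓝 x)) : x ∈ F := by
  let T := {𝒢 : Filter X // 𝒢.NeBot ∧ 𝒢.IsCountablyGenerated ∧ 𝒢 ≤ 𝓝 x ∧ F ∈ 𝒢}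
  have hT : ∀ {y : ℕ → X}, (∀ n, y n ∈ F) → Tendsto y atTop (𝓝 x) →
      (map y atTop).NeBot ∧ (map y atTop).IsCountablyGenerated ∧ map y atTop ≤ 𝓝 x ∧
        F ∈ map y atTop := fun hy hyx =>
    ⟨inferInstance, inferInstance, hyx, mem_map.2 (univ_mem' hy)⟩
  choose l hlF hlK hl using fun 𝒢 : T =>
    have := 𝒢.2.1
    have := 𝒢.2.2.1
    exists_liminf hsemi hcomp hF hFc 𝒢.1 𝒢.2.2.2.2
  have hlmono : ∀ {𝒢 ℋ : T}, ℋ.1 ≤ 𝒢.1 → l 𝒢 ≤ l ℋ := fun {𝒢 ℋ} h =>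
    (hl 𝒢).2 fun m ⟨G, hG, hm⟩ => (hl ℋ).1 ⟨G, h hG, hm⟩
  let r : T → T → Prop := fun 𝒢 ℋ => 𝒢 = ℋ ∨ (ℋ.1 ≤ 𝒢.1 ∧ l 𝒢 < l ℋ)
  have hr_le : ∀ {𝒢 ℋ}, r 𝒢 ℋ → ℋ.1 ≤ 𝒢.1 := by
    rintro 𝒢 ℋ (rfl | h)
    exacts [le_rfl, h.1]
  have hIic : ∀ a : X, IsClosed (Iic a) := fun a => by
    have : Iic a = {z | a ⊓ z = z} := by
      ext z
      simp
    rw [this]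
    exact isClosed_eq (hsemi a) continuous_id
  have : Nonempty T := ⟨⟨map u atTop, hT hu hux⟩⟩
  obtain ⟨𝒢, h𝒢⟩ := exists_maximal_of_nonempty_chains_bounded (r := r) (by
    intro c hc hne
    by_cases hmax : ∃ a ∈ c, ∀ b ∈ c, r b a
    · exact hmax.imp fun a ha => ha.2
    push Not at hmax
    have htot : ∀ a ∈ c, ∀ b ∈ c, r a b ∨ r b a := fun a ha b hb => by
      by_cases h : a = b
      · exact .inl (.inl h)
      · exact hc ha hb h
    have hlt : ∀ a ∈ c, ∃ b ∈ c, l a < l b := fun a ha => by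
      obtain ⟨b, hb, hab⟩ := hmax a ha
      rcases (htot a ha b hb).resolve_right hab with h | h
      · exact absurd (.inl h.symm) hab
      · exact ⟨b, hb, h.2⟩
    have hchain : IsChain (· ≤ ·) (l '' c) := by
      rintro _ ⟨a, ha, rfl⟩ _ ⟨b, hb, rfl⟩ -
      exact (htot a ha b hb).imp (fun h => hlmono (hr_le h)) fun h => hlmono (hr_le h)
    obtain ⟨s, hs, hsc⟩ := (hcomp _ (hne.image l) hchain).2
    obtain ⟨B, hBc, hB, hsB⟩ := SequentialSpace.exists_countable_subset_mem_closure hsc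
    obtain ⟨c', hc'd, hc', himg⟩ : ∃ c' ⊆ c, c'.Countable ∧ l '' c' = B := by
      obtain ⟨c', hc', hbij⟩ := SurjOn.exists_bijOn_subset (show SurjOn l c B from hBc)
      exact ⟨c', hc', countable_of_injective_of_countable_image hbij.injOn (hbij.image_eq ▸ hB), hbij.image_eq⟩
    have hcof : ∀ a ∈ c, ∃ a' ∈ c', a'.1 ≤ a.1 ∧ l a < l a' := by
      intro a ha
      by_contra! hcon
      have hsub : B ⊆ Iic (l a) := by
        rw [← himg]
        rintro _ ⟨a', ha', rfl⟩
        rcases htot a ha a' (hc'd ha') with (rfl | h) | h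
        · exact le_rfl
        · exact absurd h.2 (hcon a' ha' h.1)
        · exact hlmono (hr_le h)
      obtain ⟨b, hb, hab⟩ := hlt a ha
      exact (hab.trans_le (hs.1 ⟨b, hb, rfl⟩)).not_ge (closure_minimal hsub (hIic _) hsB)
    have hne' : Nonempty c' := by
      obtain ⟨a, ha⟩ := hne
      obtain ⟨a', ha', -⟩ := hcof a ha
      exact ⟨⟨a', ha'⟩⟩
    have := hc'.to_subtype
    have hdir : Directed (· ≥ ·) fun a : c' => a.1.1 := fun a b => by
      rcases htot a (hc'd a.2) b (hc'd b.2) with h | h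
      · exact ⟨b, hr_le h, le_rfl⟩
      · exact ⟨a, le_rfl, hr_le h⟩
    obtain ⟨a₀⟩ := id hne'
    have hgen := fun a : c' => a.1.2.2.1
    let ℋ : T := ⟨⨅ a : c', a.1.1, iInf_neBot_of_directed' hdir fun a => a.1.2.1,
      inferInstance, (iInf_le _ a₀).trans a₀.1.2.2.2.1, iInf_le (fun a : c' => a.1.1) a₀
      a₀.1.2.2.2.2⟩
    refine ⟨ℋ, fun a ha => ?_⟩
    obtain ⟨a', ha', hle, hlt'⟩ := hcof a ha
    have hℋ : ℋ.1 ≤ a'.1 := iInf_le (fun a : c' => a.1.1) ⟨a', ha'⟩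
    exact .inr ⟨hℋ.trans hle, hlt'.trans_le (hlmono hℋ)⟩)
    (by
      rintro a b c (rfl | hab) (rfl | hbc)
      exacts [.inl rfl, .inr hbc, .inr hab, .inr ⟨hbc.1.trans hab.1, hab.2.trans hbc.2⟩])
  have hstable : ∀ ℋ : T, ℋ.1 ≤ 𝒢.1 → l ℋ = l 𝒢 := fun ℋ h => by
    by_contra hne
    have hlt := lt_of_le_of_ne (hlmono h) (Ne.symm hne)
    rcases h𝒢 ℋ (.inr ⟨h, hlt⟩) with h | h
    · exact hne (congrArg l h)
    · exact lt_asymm hlt h.2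
  suffices h : l 𝒢 = x from h ▸ hlF 𝒢
  by_contra hne
  obtain ⟨V, V', hV, hV', hxV, hlV', hdisj⟩ := t2_separation (Ne.symm hne)
  have := 𝒢.2.1
  have := 𝒢.2.2.1
  obtain ⟨G, hG⟩ := 𝒢.1.exists_antitone_basis
  obtain ⟨y, hyG, hyV⟩ := exists_seq_infClosure_subset hsemi (V := fun _ : ℕ => V)
    (H := fun n => G n ∩ F) (fun _ => hV) (fun _ => hxV)
    (fun n => inter_subset_right.trans hFx)
    (fun n O hO hxO => 𝒢.1.nonempty_of_mem (inter_mem (inter_mem (hG.mem n) 𝒢.2.2.2.2)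
      (𝒢.2.2.2.1 (iInter_mem.2 fun j => (hO j).mem_nhds (hxO j)))))
  have hy𝒢 : map y atTop ≤ 𝒢.1 := hG.tendsto fun n => (hyG n).1
  let ℋ : T := ⟨map y atTop, hT (fun n => (hyG n).2) (hy𝒢.trans 𝒢.2.2.2.1)⟩
  have hlℋ := closure_mono (hyV 0) (hlK ℋ (y '' Ioi 0) (image_mem_map (Ioi_mem_atTop 0)))
  rw [hstable ℋ hy𝒢] at hlℋ
  exact (hdisj.closure_left hV').notMem_of_mem_left hlℋ hlV'

end Sequential

/-- Let `X` be a complete Hausdorff semitopological semilattice satisfying at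
least one of: (1) `(x,y) ↦ x ⊓ y` is jointly continuous; (2) `X` is sequential; (3) `X`
admits an injective continuous map to a T2δ-space; (4) `X` is functionally Hausdorff.
Then every Scott-open subset of `X` is open. -/
theorem stmt11 {X : Type u} [SemilatticeInf X] [TopologicalSpace X] [T2Space X]
    (hsemi : ∀ a : X, Continuous fun x => a ⊓ x)
    (hcomp : CompleteTS X)
    (hcond : (Continuous fun p : X × X => p.1 ⊓ p.2) ∨
      SequentialSpace X ∨
      (∃ (Y : Type u) (tY : TopologicalSpace Y) (f : X → Y),
        @T2DeltaSpace Y tY ∧ Function.Injective f ∧ @Continuous X Y _ tY f) ∨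
      (∀ x y : X, x ≠ y → ∃ f : X → ℝ, Continuous f ∧ f x ≠ f y)) :
    ∀ U : Set X, ScottOpen X U → IsOpen U := by
  intro U hU
  rw [← isClosed_compl_iff]
  have hF : IsLowerSet Uᶜ := hU.1.compl
  have hFx : ∀ x : X, IsLowerSet (Uᶜ ∩ Iic x) := fun x => hF.inter (isLowerSet_Iic x)
  have hFc : ∀ x : X, ChainSupClosed (Uᶜ ∩ Iic x) := hU.chainSupClosed_compl.inter_Iic
  have hmem : ∀ x, ∀ z ∈ Uᶜ, x ⊓ z ∈ Uᶜ ∩ Iic x := fun x z hz =>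
    ⟨hF inf_le_right hz, inf_le_left⟩
  have hclosed (H : ∀ x, x ∈ closure (Uᶜ ∩ Iic x) → x ∈ Uᶜ ∩ Iic x) : IsClosed Uᶜ := by
    refine isClosed_of_closure_subset fun x hx => (H x ?_).1
    simpa using map_mem_closure (hsemi x) hx (hmem x)
  rcases hcond with hinf | hseq | ⟨Y, tY, f, hY, hfi, hfc⟩ | hsep
  · exact hclosed fun x => mem_of_mem_closure_of_continuous_inf hinf hcomp (hFx x) (hFc x)
      inter_subset_right
  · refine IsSeqClosed.isClosed fun u x hu hux => ?_
    have hlim : Tendsto (fun n => x ⊓ u n) atTop (𝓝 x) := by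
      have := (hsemi x).tendsto x
      rw [inf_idem] at this
      exact this.comp hux
    exact (mem_of_tendsto_of_sequentialSpace hsemi hcomp (hFx x) (hFc x) inter_subset_right
      (fun n => hmem x _ (hu n)) hlim).1
  · exact hclosed fun x => mem_of_mem_closure_of_injective hY hfi hfc hsemi hcomp (hFx x) (hFc x)
      inter_subset_right
  · refine hclosed fun x => mem_of_mem_closure_of_injective (Y := C(X, ℝ) → ℝ)
      (f := fun x f => f x) .of_regularSpace (fun x y hxy => ?_)
      (continuous_pi fun f => f.continuous) hsemi hcomp (hFx x) (hFc x) inter_subset_right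
    by_contra hne
    obtain ⟨f, hf, hfxy⟩ := hsep x y hne
    exact hfxy (congrFun hxy ⟨f, hf⟩)
end

section
/- For any complete topologized semilattice X the I-weak topology is contained in the Lawson topology: 𝒲_X ⊆ Λ_X. -/
open Set TopologicalSpace

variable (X : Type*)

section Helpers

variable {X : Type*} [SemilatticeInf X] [TopologicalSpace X]

/-- In a complete topologized semilattice, a nonempty subsemilattice closed under infima of
chains has a least element. -/
theorem CompleteTS.exists_isLeast_s12 (hcomp : CompleteTS X) {F : Set X} (hne : F.Nonempty)
    (hinf : ∀ x ∈ F, ∀ y ∈ F, x ⊓ y ∈ F)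
    (hchain : ∀ C ⊆ F, C.Nonempty → IsChain (· ≤ ·) C → ∀ a, IsGLB C a → a ∈ closure C → a ∈ F) :
    ∃ m, IsLeast F m := by
  obtain ⟨x, hx⟩ := hne
  obtain ⟨m, -, hm⟩ := zorn_le_nonempty₀ (α := Xᵒᵈ) (OrderDual.ofDual ⁻¹' F)
    (fun C hCF hC y hy => by
      have hC' : IsChain (· ≤ ·) (OrderDual.toDual ⁻¹' C) :=
        fun a ha b hb hab => (hC ha hb hab).symm
      obtain ⟨a, ha, hac⟩ := (hcomp (OrderDual.toDual ⁻¹' C) ⟨_, hy⟩ hC').1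
      exact ⟨OrderDual.toDual a, hchain _ hCF ⟨_, hy⟩ hC' a ha hac, fun z hz => ha.1 hz⟩)
    (OrderDual.toDual x) hx
  refine ⟨OrderDual.ofDual m, hm.1, fun y hy => ?_⟩
  have h : OrderDual.ofDual m ≤ OrderDual.ofDual m ⊓ y :=
    hm.2 (y := OrderDual.toDual (OrderDual.ofDual m ⊓ y)) (hinf _ hm.1 y hy)
      (inf_le_left : OrderDual.ofDual m ⊓ y ≤ OrderDual.ofDual m)
  exact h.trans inf_le_right

/-- Complete topologized semilattices are bounded-complete. -/
theorem CompleteTS.exists_isLUB (hcomp : CompleteTS X) {A : Set X} (hA : BddAbove A) :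
    ∃ m, IsLUB A m :=
  hcomp.exists_isLeast_s12 hA (fun _ hx _ hy _ hz => le_inf (hx hz) (hy hz))
    fun _ hC _ _ _ ha _ _ hz => ha.2 fun _ hc => hC hc hz

/-- A lower set closed under suprema of chains is closed under suprema of directed sets. -/
theorem CompleteTS.isLUB_mem_of_directedOn (hcomp : CompleteTS X) {S : Set X}
    (hS : IsLowerSet S)
    (hchain : ∀ C ⊆ S, C.Nonempty → IsChain (· ≤ ·) C → ∀ a, IsLUB C a → a ∈ closure C → a ∈ S)
    {D : Set X} (hne : D.Nonempty) (hD : DirectedOn (· ≤ ·) D) (hDS : D ⊆ S) {a : X}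
    (ha : IsLUB D a) : a ∈ S := by
  have hjoin : ∀ x y, ∃ z, x ≤ a → y ≤ a → IsLUB {x, y} z := by
    intro x y
    by_cases h : x ≤ a ∧ y ≤ a
    · obtain ⟨z, hz⟩ := hcomp.exists_isLUB (A := {x, y}) ⟨a, by simp [h.1, h.2]⟩
      exact ⟨z, fun _ _ => hz⟩
    · exact ⟨x, fun h₁ h₂ => (h ⟨h₁, h₂⟩).elim⟩
  choose J hJ using hjoin
  have left {x y} (hx : x ≤ a) (hy : y ≤ a) : x ≤ J x y := (hJ x y hx hy).1 (by simp)
  have right {x y} (hx : x ≤ a) (hy : y ≤ a) : y ≤ J x y := (hJ x y hx hy).1 (by simp)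
  have le {x y z} (hx : x ≤ a) (hy : y ≤ a) (hxz : x ≤ z) (hyz : y ≤ z) : J x y ≤ z :=
    (hJ x y hx hy).2 (by simp [hxz, hyz])
  have hDa : ∀ d ∈ D, d ≤ a := fun d hd => ha.1 hd
  obtain ⟨d₀, hd₀⟩ := hne
  -- Any maximal element of the following set is an upper bound of `D` lying in `S`.
  obtain ⟨m, -, hm⟩ := zorn_le_nonempty₀ {x | x ≤ a ∧ ∀ d ∈ D, J x d ∈ S}
    (fun C hCT hC y hy => by
      obtain ⟨b, hb, -⟩ := (hcomp C ⟨y, hy⟩ hC).2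
      have hba : b ≤ a := hb.2 fun c hc => (hCT hc).1
      refine ⟨b, ⟨hba, fun d hd => ?_⟩, fun z hz => hb.1 hz⟩
      have hda := hDa d hd
      have hC' : IsChain (· ≤ ·) ((J · d) '' C) := by
        have hmono {u v} (hu : u ∈ C) (hv : v ∈ C) (h : u ≤ v) : J u d ≤ J v d :=
          le (hCT hu).1 hda (h.trans (left (hCT hv).1 hda)) (right (hCT hv).1 hda)
        rintro _ ⟨u, hu, rfl⟩ _ ⟨v, hv, rfl⟩ -
        exact (hC.total hu hv).imp (hmono hu hv) (hmono hv hu)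
      have hne' : ((J · d) '' C).Nonempty := ⟨_, y, hy, rfl⟩
      obtain ⟨s, hs, hsc⟩ := (hcomp _ hne' hC').2
      refine hS (le hba hda (hb.2 fun c hc => ?_) ?_)
        (hchain _ (by rintro _ ⟨c, hc, rfl⟩; exact (hCT hc).2 d hd) hne' hC' s hs hsc)
      · exact (left (hCT hc).1 hda).trans (hs.1 ⟨c, hc, rfl⟩)
      · exact (right (hCT hy).1 hda).trans (hs.1 ⟨y, hy, rfl⟩))
    d₀ ⟨hDa _ hd₀, fun d hd => by
      obtain ⟨e, he, h₁, h₂⟩ := hD d₀ hd₀ d hd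
      exact hS (le (hDa _ hd₀) (hDa d hd) h₁ h₂) (hDS he)⟩
  obtain ⟨hma, hmS⟩ := hm.1
  have hub : ∀ d ∈ D, d ≤ m := by
    intro d hd
    have hda := hDa d hd
    have hJa : J m d ≤ a := le hma hda hma hda
    refine (right hma hda).trans (hm.2 ⟨hJa, fun e he => ?_⟩ (left hma hda))
    obtain ⟨f, hf, h₁, h₂⟩ := hD d hd e he
    have hfa := hDa f hf
    exact hS (le hJa (hDa e he) (le hma hda (left hma hfa) (h₁.trans (right hma hfa)))
      (h₂.trans (right hma hfa))) (hmS f hf)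
  exact hS ((ha.2 hub).trans (left hma (hDa _ hd₀))) (hmS d₀ hd₀)

/-- Continuous homomorphisms of a complete topologized semilattice to `[0,1]` are continuous
in the Lawson topology. -/
theorem CompleteTS.continuous_lawsonTop (hcomp : CompleteTS X) {h : X → unitInterval}
    (hc : Continuous h) (hmin : ∀ x y : X, h (x ⊓ y) = min (h x) (h y)) :
    @Continuous X unitInterval (lawsonTop X) _ h := by
  have hmono : Monotone h := fun x y hxy => by
    rw [← inf_eq_left.2 hxy, hmin]
    exact min_le_right _ _
  rw [OrderTopology.topology_eq_generate_intervals (α := unitInterval)]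
  refine (@continuous_generateFrom_iff _ _ _ (lawsonTop X) _).2 ?_
  rintro _ ⟨t, rfl | rfl⟩
  · refine GenerateOpen.basic _ (Or.inl ⟨fun x y hxy hx => lt_of_lt_of_le hx (hmono hxy), ?_⟩)
    intro D hne hD a ha hat
    by_contra hemp
    have hDS : D ⊆ h ⁻¹' Iic t := fun d hd =>
      le_of_not_gt (a := h d) (b := t) fun hlt => hemp ⟨d, hd, hlt⟩
    have haS : a ∈ h ⁻¹' Iic t := hcomp.isLUB_mem_of_directedOn
      (fun x y hxy hx => (hmono hxy).trans hx)
      (fun C hC _ _ b _ hb => closure_minimal hC (isClosed_Iic.preimage hc) hb)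
      hne hD hDS ha
    exact not_le_of_gt (a := t) (b := h a) hat haS
  · rcases Set.eq_empty_or_nonempty (h ⁻¹' Ici t) with hemp | hne
    · convert @isOpen_univ X (lawsonTop X)
      exact Set.eq_univ_of_forall fun x => lt_of_not_ge (a := h x) (b := t) fun hx =>
        Set.eq_empty_iff_forall_notMem.1 hemp x hx
    · obtain ⟨m, hm, hle⟩ := hcomp.exists_isLeast_s12 hne
        (fun x hx y hy => by
          change t ≤ h (x ⊓ y)
          rw [hmin]
          exact le_min hx hy)
        (fun C hC _ _ b _ hb => closure_minimal hC (isClosed_Ici.preimage hc) hb)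
      refine GenerateOpen.basic _ (Or.inr ⟨m, ?_⟩)
      ext x
      exact ⟨fun hx hmx => not_le_of_gt (a := h x) (b := t) hx (le_trans hm (hmono hmx)),
        fun hx => lt_of_not_ge (a := h x) (b := t) fun htx => hx (hle htx)⟩

end Helpers

/-- For any complete topologized semilattice `X` the `𝕀`-weak topology is
contained in the Lawson topology: `𝒲_X ⊆ Λ_X`. -/
theorem stmt12 {X : Type*} [SemilatticeInf X] [TopologicalSpace X]
    (hcomp : CompleteTS X) :
    ∀ U : Set X, @IsOpen X (iweakTop X) U → @IsOpen X (lawsonTop X) U := by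
  exact le_generateFrom (by
    rintro _ ⟨h, hc, hmin, U, hU, rfl⟩
    exact @Continuous.isOpen_preimage _ _ (lawsonTop X) _ h
      (hcomp.continuous_lawsonTop hc hmin) U hU)
end

section
/- For a compact Hausdorff semitopological semilattice X with topology τ_X the following conditions are equivalent: (1) 𝒲_X = τ_X; (2) η_X = τ_X; (3) 𝒵_X = τ_X; (4) 𝒲_X = Λ_X; (5) Λ_X ⊆ η_X; (6) η_X is Hausdorff; (7) 𝒵_X is Hausdorff; (8) 𝒲_X is Hausdorff; (9) Λ_X is Hausdorff; (10) any distinct points of X have disjoint neighborhoods O_x ∈ η_X and O_y ∈ τ_X; (11) any distinct points of X have disjoint neighborhoods O_x ∈ 𝒵_X and O_y ∈ τ_X; (12) X is I-separated; (13) X is a W-semilattice; (14) X is a U-semilattice; (15) X is a V-semilattice. -/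
open Set TopologicalSpace

variable (X : Type*)

section SemitopologicalSemilattice

variable {Y : Type*} [SemilatticeInf Y] [TopologicalSpace Y]

theorem isClosed_Ici_of_shift [T1Space Y] (hY : ∀ a : Y, Continuous fun x => a ⊓ x) (a : Y) :
    IsClosed (Ici a) := by
  have : Ici a = (fun x => a ⊓ x) ⁻¹' {a} := by ext x; simp
  exact this ▸ isClosed_singleton.preimage (hY a)

theorem isClosed_Iic_of_shift [T2Space Y] (hY : ∀ a : Y, Continuous fun x => a ⊓ x) (a : Y) :
    IsClosed (Iic a) := by
  have : Iic a = {x | a ⊓ x = x} := by ext x; simp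
  exact this ▸ isClosed_eq (hY a) continuous_id

/-- In a compact space, a nonempty directed family of points has a point adherent to all its
tails. -/
theorem exists_forall_mem_closure_tail {Y : Type*} [TopologicalSpace Y] [CompactSpace Y]
    {r : Y → Y → Prop} [IsTrans Y r] [Std.Refl r] {D : Set Y} (hne : D.Nonempty)
    (hD : DirectedOn r D) :
    ∃ p : Y, ∀ d ∈ D, p ∈ closure {x ∈ D | r d x} := by
  have : Nonempty D := hne.to_subtype
  obtain ⟨p, hp⟩ := IsCompact.nonempty_iInter_of_directed_nonempty_isCompact_isClosed
    (fun d : D => closure {x ∈ D | r d x}) (by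
      intro a b
      obtain ⟨c, hc, hac, hbc⟩ := hD a a.2 b b.2
      exact ⟨⟨c, hc⟩, closure_mono fun x hx => ⟨hx.1, _root_.trans hac hx.2⟩,
        closure_mono fun x hx => ⟨hx.1, _root_.trans hbc hx.2⟩⟩)
    (fun d => ⟨d, subset_closure ⟨d.2, refl _⟩⟩)
    (fun d => isClosed_closure.isCompact) (fun d => isClosed_closure)
  exact ⟨p, fun d hd => mem_iInter.1 hp ⟨d, hd⟩⟩

theorem exists_isLUB_mem_closure [CompactSpace Y] [T2Space Y]
    (hY : ∀ a : Y, Continuous fun x => a ⊓ x) {D : Set Y} (hne : D.Nonempty)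
    (hD : DirectedOn (· ≤ ·) D) : ∃ a ∈ closure D, IsLUB D a := by
  obtain ⟨p, hp⟩ := exists_forall_mem_closure_tail hne hD
  obtain ⟨d₀, hd₀⟩ := hne
  refine ⟨p, closure_mono (fun x hx => hx.1) (hp d₀ hd₀), fun d hd => ?_, fun b hb => ?_⟩
  · exact (isClosed_Ici_of_shift hY d).closure_subset_iff.2 (fun x hx => hx.2) (hp d hd)
  · exact (isClosed_Iic_of_shift hY b).closure_subset_iff.2 (fun x hx => hb hx.1) (hp d₀ hd₀)

theorem exists_isGLB_mem_closure [CompactSpace Y] [T2Space Y]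
    (hY : ∀ a : Y, Continuous fun x => a ⊓ x) {D : Set Y} (hne : D.Nonempty)
    (hD : DirectedOn (· ≥ ·) D) : ∃ a ∈ closure D, IsGLB D a := by
  obtain ⟨p, hp⟩ := exists_forall_mem_closure_tail hne hD
  obtain ⟨d₀, hd₀⟩ := hne
  refine ⟨p, closure_mono (fun x hx => hx.1) (hp d₀ hd₀), fun d hd => ?_, fun b hb => ?_⟩
  · exact (isClosed_Iic_of_shift hY d).closure_subset_iff.2 (fun x hx => hx.2) (hp d hd)
  · exact (isClosed_Ici_of_shift hY b).closure_subset_iff.2 (fun x hx => hb hx.1) (hp d₀ hd₀)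

theorem IsLUB.mem_closure_of_shift [CompactSpace Y] [T2Space Y]
    (hY : ∀ a : Y, Continuous fun x => a ⊓ x) {D : Set Y} {a : Y} (h : IsLUB D a)
    (hne : D.Nonempty) (hD : DirectedOn (· ≤ ·) D) : a ∈ closure D := by
  obtain ⟨b, hb, hlub⟩ := exists_isLUB_mem_closure hY hne hD
  exact h.unique hlub ▸ hb

theorem IsGLB.mem_closure_of_shift [CompactSpace Y] [T2Space Y]
    (hY : ∀ a : Y, Continuous fun x => a ⊓ x) {D : Set Y} {a : Y} (h : IsGLB D a)
    (hne : D.Nonempty) (hD : DirectedOn (· ≥ ·) D) : a ∈ closure D := by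
  obtain ⟨b, hb, hglb⟩ := exists_isGLB_mem_closure hY hne hD
  exact h.unique hglb ▸ hb

theorem InfClosed.directedOn_ge {Y : Type*} [SemilatticeInf Y] {S : Set Y} (hS : InfClosed S) :
    DirectedOn (· ≥ ·) S :=
  fun _ ha _ hb => ⟨_, hS ha hb, inf_le_left, inf_le_right⟩

theorem exists_isGLB_of_nonempty [CompactSpace Y] [T2Space Y]
    (hY : ∀ a : Y, Continuous fun x => a ⊓ x) {S : Set Y} (hne : S.Nonempty) :
    ∃ a, IsGLB S a := by
  obtain ⟨a, -, ha⟩ := exists_isGLB_mem_closure hY (hne.mono subset_infClosure)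
    infClosed_infClosure.directedOn_ge
  exact ⟨a, isGLB_infClosure.1 ha⟩

theorem InfClosed.exists_isLeast [CompactSpace Y] [T2Space Y]
    (hY : ∀ a : Y, Continuous fun x => a ⊓ x) {S : Set Y} (hS : InfClosed S)
    (hc : IsClosed S) (hne : S.Nonempty) : ∃ a, IsLeast S a := by
  obtain ⟨a, hac, ha⟩ := exists_isGLB_mem_closure hY hne hS.directedOn_ge
  exact ⟨a, hc.closure_subset hac, ha.1⟩

theorem InfClosed.closure_of_shift (hY : ∀ a : Y, Continuous fun x => a ⊓ x) {S : Set Y}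
    (hS : InfClosed S) : InfClosed (closure S) := by
  have h₁ : ∀ s ∈ S, ∀ t ∈ closure S, s ⊓ t ∈ closure S := fun s hs t ht =>
    map_mem_closure (hY s) ht fun u hu => hS hs hu
  intro a ha b hb
  have h₂ : b ⊓ a ∈ closure (closure S) := map_mem_closure (hY b) ha fun u hu => by
    rw [inf_comm]; exact h₁ u hu b hb
  rw [inf_comm]
  simpa using h₂

end SemitopologicalSemilattice

section CompleteSubsemilattice

variable {Y : Type*} [SemilatticeInf Y] [TopologicalSpace Y]

/-- A transfinite version of the double limit construction: points `x α ∈ A` are chosen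
recursively so that the infima of all their segments stay in the prescribed sets `O δ`. -/
theorem exists_mem_forall_mem_closure_s18 [CompactSpace Y] [T2Space Y]
    (hY : ∀ a : Y, Continuous fun x => a ⊓ x) {A : Set Y} (hA : A.Nonempty)
    (hinf : ∀ S ⊆ A, S.Nonempty → ∀ a, IsGLB S a → a ∈ A)
    (hsup : ∀ D ⊆ A, D.Nonempty → DirectedOn (· ≤ ·) D → ∀ a, IsLUB D a → a ∈ A)
    {ι : Type*} [LinearOrder ι] [WellFoundedLT ι] [Nonempty ι] (O : ι → Set Y)
    (hstep : ∀ α (s : ι → Y), (∀ β < α, ∀ δ ≤ β, s β ∈ O δ) →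
      ∃ z ∈ A, ∀ δ ≤ α, z ∈ O δ ∧ ∀ β, δ ≤ β → β < α → z ⊓ s β ∈ O δ)
    (hlim : ∀ α β δ, β < α → ∀ u : ι → Y, (∀ γ ∈ Ico β α, u γ ∈ O δ) →
      AntitoneOn u (Ico β α) → ∀ a, IsGLB (u '' Ico β α) a → a ∈ O δ) :
    ∃ y ∈ A, ∀ δ, y ∈ closure (O δ) := by
  classical
  have : Nonempty Y := hA.to_type
  have hI : ∀ S : Set Y, ∃ a, S.Nonempty → IsGLB S a := fun S => by
    by_cases hS : S.Nonempty
    · exact (exists_isGLB_of_nonempty hY hS).imp fun a ha _ => ha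
    · exact ⟨Classical.arbitrary Y, fun h => absurd h hS⟩
  choose I hI using hI
  have hpick : ∀ α (s : ι → Y), ∃ z, (∀ β < α, ∀ δ ≤ β, s β ∈ O δ) →
      z ∈ A ∧ ∀ δ ≤ α, z ∈ O δ ∧ ∀ β, δ ≤ β → β < α → z ⊓ s β ∈ O δ := fun α s => by
    by_cases hs : ∀ β < α, ∀ δ ≤ β, s β ∈ O δ
    · exact (hstep α s hs).imp fun z hz _ => hz
    · exact ⟨Classical.arbitrary Y, fun h => absurd h hs⟩
  choose pick hpick using hpick
  let x : ι → Y := WellFoundedLT.fix (motive := fun _ => Y) fun α ih =>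
    pick α fun β => I {w | ∃ γ, ∃ h : γ < α, β ≤ γ ∧ ih γ h = w}
  have hx : ∀ α, x α = pick α fun β => I (x '' Ico β α) := fun α => by
    simp only [x]
    rw [WellFoundedLT.fix_eq]
    congr! 3 with β
    ext w
    constructor
    · rintro ⟨γ, h₁, h₂, h₃⟩
      exact ⟨γ, ⟨h₂, h₁⟩, h₃⟩
    · rintro ⟨γ, ⟨h₂, h₁⟩, h₃⟩
      exact ⟨γ, h₁, h₂, h₃⟩
  let u : ι → ι → Y := fun β γ => I (x '' Icc β γ)
  have hu : ∀ β γ, β ≤ γ → IsGLB (x '' Icc β γ) (u β γ) := fun β γ h =>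
    hI _ ((nonempty_Icc.2 h).image _)
  have hu_anti : ∀ β γ γ', β ≤ γ → γ ≤ γ' → u β γ' ≤ u β γ := fun β γ γ' h h' =>
    (hu β γ h).mono (hu β γ' (h.trans h')) (image_mono (Icc_subset_Icc_right h'))
  have hu_glb : ∀ β α, β < α → IsGLB (u β '' Ico β α) (I (x '' Ico β α)) := fun β α h => by
    have h₀ := hI (x '' Ico β α) ((nonempty_Ico.2 h).image _)
    constructor
    · rintro _ ⟨γ, hγ, rfl⟩
      exact (hu β γ hγ.1).mono h₀ (image_mono (Icc_subset_Ico_right hγ.2))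
    · intro b hb
      refine h₀.2 ?_
      rintro _ ⟨γ, hγ, rfl⟩
      exact (hb ⟨γ, hγ, rfl⟩).trans ((hu β γ hγ.1).1 ⟨γ, ⟨hγ.1, le_rfl⟩, rfl⟩)
  have key : ∀ α, x α ∈ A ∧ ∀ β ≤ α, ∀ δ ≤ β, u β α ∈ O δ := fun α => by
    induction α using WellFoundedLT.induction with
    | ind α ih =>
      have hs : ∀ β < α, ∀ δ ≤ β, I (x '' Ico β α) ∈ O δ := fun β hβ δ hδ =>
        hlim α β δ hβ (u β) (fun γ hγ => (ih γ hγ.2).2 β hγ.1 δ hδ)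
          (fun γ hγ γ' _ h => hu_anti β γ γ' hγ.1 h) _ (hu_glb β α hβ)
      obtain ⟨hxA, hxO⟩ := hpick α _ hs
      rw [← hx] at hxA hxO
      refine ⟨hxA, fun β hβ δ hδ => ?_⟩
      rcases hβ.eq_or_lt with rfl | hβ
      · have : u β β = x β := (hu β β le_rfl).unique (by simp)
        exact this ▸ (hxO δ hδ).1
      · have : u β α = x α ⊓ I (x '' Ico β α) := by
          refine (hu β α hβ.le).unique ?_
          rw [← Ico_insert_right hβ.le, image_insert_eq]
          exact (hI _ ((nonempty_Ico.2 hβ).image _)).insert _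
        exact this ▸ (hxO δ (hδ.trans hβ.le)).2 β hδ hβ
  let t : ι → Y := fun β => I (x '' Ici β)
  have ht : ∀ β, IsGLB (x '' Ici β) (t β) := fun β => hI _ (nonempty_Ici.image _)
  have ht_mono : Monotone t := fun β β' h =>
    (ht β').mono (ht β) (image_mono (Ici_subset_Ici.2 h))
  have htA : ∀ β, t β ∈ A := fun β => hinf _ (by
    rintro _ ⟨γ, -, rfl⟩
    exact (key γ).1) (nonempty_Ici.image _) _ (ht β)
  have htO : ∀ β, ∀ δ ≤ β, t β ∈ closure (O δ) := fun β δ hδ => by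
    have hglb : IsGLB (u β '' Ici β) (t β) := by
      constructor
      · rintro _ ⟨γ, hγ, rfl⟩
        exact (hu β γ hγ).mono (ht β) (image_mono Icc_subset_Ici_self)
      · intro b hb
        refine (ht β).2 ?_
        rintro _ ⟨γ, hγ, rfl⟩
        exact (hb ⟨γ, hγ, rfl⟩).trans ((hu β γ hγ).1 ⟨γ, ⟨hγ, le_rfl⟩, rfl⟩)
    refine closure_mono ?_ (hglb.mem_closure_of_shift hY (nonempty_Ici.image _) ?_)
    · rintro _ ⟨γ, hγ, rfl⟩
      exact (key γ).2 β hγ δ hδ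
    · rintro _ ⟨γ, hγ, rfl⟩ _ ⟨γ', hγ', rfl⟩
      exact ⟨u β (max γ γ'), ⟨_, le_max_of_le_left hγ, rfl⟩,
        hu_anti _ _ _ hγ (le_max_left _ _), hu_anti _ _ _ hγ' (le_max_right _ _)⟩
  obtain ⟨y, -, hy⟩ := exists_isLUB_mem_closure hY (range_nonempty t)
    (directedOn_range.2 ht_mono.directed_le)
  refine ⟨y, hsup _ (range_subset_iff.2 htA) (range_nonempty t)
    (directedOn_range.2 ht_mono.directed_le) y hy, fun δ => ?_⟩
  have hlub : IsLUB (t '' Ici δ) y := by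
    refine ⟨fun w hw => hy.1 (image_subset_range _ _ hw), fun b hb => hy.2 ?_⟩
    rintro _ ⟨β, rfl⟩
    exact (ht_mono (le_max_left β δ)).trans (hb ⟨_, le_max_right β δ, rfl⟩)
  refine isClosed_closure.closure_subset_iff.2 ?_
    (hlub.mem_closure_of_shift hY (nonempty_Ici.image _) ?_)
  · rintro _ ⟨β, hβ, rfl⟩
    exact htO β δ hβ
  · rintro _ ⟨β, hβ, rfl⟩ _ ⟨γ, hγ, rfl⟩
    exact ⟨t (max β γ), ⟨_, le_max_of_le_left hβ, rfl⟩, ht_mono (le_max_left _ _),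
      ht_mono (le_max_right _ _)⟩

theorem IsGδ.inter_nonempty_of_mem_closure [CompactSpace Y] [T2Space Y]
    (hY : ∀ a : Y, Continuous fun x => a ⊓ x) {A : Set Y}
    (hinf : ∀ S ⊆ A, S.Nonempty → ∀ a, IsGLB S a → a ∈ A)
    (hsup : ∀ D ⊆ A, D.Nonempty → DirectedOn (· ≤ ·) D → ∀ a, IsLUB D a → a ∈ A)
    {K : Set Y} (hK : IsGδ K) {x : Y} (hxA : x ∈ closure A) (hxK : x ∈ K) :
    (A ∩ K).Nonempty := by
  obtain ⟨W, hWo, rfl⟩ := isGδ_iff_eq_iInter_nat.1 hK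
  have hV : ∀ n, ∃ V : Set Y, IsOpen V ∧ x ∈ V ∧ closure V ⊆ W n := fun n => by
    obtain ⟨V, hV, hVc, hVW⟩ := exists_mem_nhds_isClosed_subset
      ((hWo n).mem_nhds (mem_iInter.1 hxK n))
    exact ⟨interior V, isOpen_interior, mem_interior_iff_mem_nhds.2 hV,
      (closure_minimal interior_subset hVc).trans hVW⟩
  choose V hVo hxV hVW using hV
  let O : ℕ → Set Y := fun n => V n ∩ (fun z => x ⊓ z) ⁻¹' V n
  have hO : ∀ n, IsOpen (O n) := fun n => (hVo n).inter ((hVo n).preimage (hY x))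
  have hxO : ∀ n, x ∈ O n := fun n => ⟨hxV n, by simpa using hxV n⟩
  have hstab : ∀ n, ∀ z ∈ O n, x ⊓ z ∈ O n := fun n z hz => ⟨hz.2, by simpa using hz.2⟩
  suffices h : ∃ y ∈ A, ∀ n, y ∈ closure (O n) by
    obtain ⟨y, hyA, hy⟩ := h
    exact ⟨y, hyA, mem_iInter.2 fun n => hVW n (closure_mono inter_subset_left (hy n))⟩
  refine exists_mem_forall_mem_closure_s18 hY (closure_nonempty_iff.1 ⟨x, hxA⟩) hinf hsup O ?_ ?_
  · intro α s hs
    have hev : ∀ᶠ z in nhds x, ∀ δ ∈ Iic α, z ∈ O δ ∧ ∀ β ∈ Ico δ α, z ⊓ s β ∈ O δ := by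
      refine (Filter.eventually_all_finite (finite_Iic α)).2 fun δ _ => ?_
      refine Filter.Eventually.and ((hO δ).mem_nhds (hxO δ))
        ((Filter.eventually_all_finite (finite_Ico δ α)).2 fun β hβ => ?_)
      have hc : Continuous fun z => z ⊓ s β := by simpa only [inf_comm] using hY (s β)
      exact hc.continuousAt ((hO δ).mem_nhds (hstab δ _ (hs β hβ.2 δ hβ.1)))
    obtain ⟨z, hzA, hz⟩ := ((mem_closure_iff_frequently.1 hxA).and_eventually hev).exists
    exact ⟨z, hzA, fun δ hδ => ⟨(hz δ hδ).1, fun β h₁ h₂ => (hz δ hδ).2 β ⟨h₁, h₂⟩⟩⟩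
  · intro α β δ hβ u hu hanti a ha
    have hmem : α - 1 ∈ Ico β α := ⟨by omega, by omega⟩
    have : a = u (α - 1) := ha.unique ⟨by
      rintro _ ⟨γ, hγ, rfl⟩
      exact hanti hγ hmem (by have := hγ.2; omega), fun b hb => hb ⟨_, hmem, rfl⟩⟩
    exact this ▸ hu _ hmem

open Cardinal in
theorem exists_mem_forall_mem_of_isClosed_isGδ {Y : Type*} [SemilatticeInf Y]
    [TopologicalSpace Y] [CompactSpace Y] [T2Space Y]
    (hY : ∀ a : Y, Continuous fun x => a ⊓ x) {A : Set Y}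
    (hinf : ∀ S ⊆ A, S.Nonempty → ∀ a, IsGLB S a → a ∈ A)
    (hsup : ∀ D ⊆ A, D.Nonempty → DirectedOn (· ≤ ·) D → ∀ a, IsLUB D a → a ∈ A)
    {x : Y} (hxA : x ∈ closure A) {ι : Type*} (K : ι → Set Y) (hc : ∀ i, IsClosed (K i))
    (hG : ∀ i, IsGδ (K i)) (hx : ∀ i, x ∈ K i) : ∃ y ∈ A, ∀ i, y ∈ K i := by
  induction hκ : #ι using WellFoundedLT.induction generalizing ι with
  | ind κ ih =>
    subst hκ
    by_cases hcount : Countable ι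
    · obtain ⟨y, hyA, hyK⟩ := (IsGδ.iInter hG).inter_nonempty_of_mem_closure hY hinf hsup hxA
        (mem_iInter.2 hx)
      exact ⟨y, hyA, mem_iInter.1 hyK⟩
    have hinfinite : ℵ₀ ≤ #ι := by
      by_contra h
      exact hcount (Cardinal.mk_le_aleph0_iff.1 (not_le.1 h).le)
    obtain ⟨e⟩ : Nonempty ((#ι).ord.ToType ≃ ι) := Cardinal.eq.1 (mk_ord_toType _)
    have hne : Nonempty (#ι).ord.ToType := by
      have : Nonempty ι := mk_ne_zero_iff.1 (aleph0_pos.trans_le hinfinite).ne'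
      exact e.symm.nonempty_congr.1 this
    let O : (#ι).ord.ToType → Set Y := fun i => K (e i) ∩ (fun z => x ⊓ z) ⁻¹' K (e i)
    have hOc : ∀ i, IsClosed (O i) := fun i => (hc _).inter ((hc _).preimage (hY x))
    have hOG : ∀ i, IsGδ (O i) := fun i => (hG _).inter ((hG _).preimage (hY x))
    have hxO : ∀ i, x ∈ O i := fun i => ⟨hx _, by simpa using hx _⟩
    have hstab : ∀ i, ∀ z ∈ O i, x ⊓ z ∈ O i := fun i z hz => ⟨hz.2, by simpa using hz.2⟩
    suffices h : ∃ y ∈ A, ∀ i, y ∈ closure (O i) by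
      obtain ⟨y, hyA, hy⟩ := h
      refine ⟨y, hyA, fun i => ?_⟩
      have := (hOc _).closure_subset (hy (e.symm i))
      simpa using this.1
    refine exists_mem_forall_mem_closure_s18 hY (closure_nonempty_iff.1 ⟨x, hxA⟩) hinf hsup O ?_ ?_
    · intro α s hs
      have hcard : #(Iic α) < #ι := by
        have h : #(Iic α) ≤ #(Iio α) + 1 := by
          rw [← Iio_insert]
          exact mk_insert_le
        have h' : #(Iio α) < #((#ι).ord.ToType) := mk_Iio_lt α (by simp)
        rw [mk_ord_toType] at h'
        exact h.trans_lt (add_lt_of_lt hinfinite h' (one_lt_aleph0.trans_le hinfinite))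
      obtain ⟨z, hzA, hz⟩ := ih #(Iic α × Iic α)
        (by rw [← mul_def]; exact mul_lt_of_lt hinfinite hcard hcard)
        (fun p => O p.1 ∩ {z | p.1 ≤ p.2 → p.2.1 < α → s p.2 ⊓ z ∈ O p.1})
        (fun p => (hOc _).inter (by
          by_cases h : p.1 ≤ p.2 ∧ p.2.1 < α
          · simp only [h.1, h.2, forall_const]
            exact (hOc p.1).preimage (hY (s p.2))
          · simp [← and_imp, h]))
        (fun p => (hOG _).inter (by
          by_cases h : p.1 ≤ p.2 ∧ p.2.1 < α
          · simp only [h.1, h.2, forall_const]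
            exact (hOG p.1).preimage (hY (s p.2))
          · simp [← and_imp, h]))
        (fun p => ⟨hxO _, fun h₁ h₂ => by
          rw [inf_comm]; exact hstab _ _ (hs _ h₂ _ h₁)⟩) rfl
      refine ⟨z, hzA, fun δ hδ => ⟨(hz (⟨δ, hδ⟩, ⟨δ, hδ⟩)).1, fun β h₁ h₂ => ?_⟩⟩
      rw [inf_comm]
      exact (hz (⟨δ, hδ⟩, ⟨β, h₂.le⟩)).2 h₁ h₂
    · intro α β δ hβ u hu hanti a ha
      refine (hOc δ).closure_subset_iff.2 ?_
        (ha.mem_closure_of_shift hY ((nonempty_Ico.2 hβ).image _) ?_)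
      · rintro _ ⟨γ, hγ, rfl⟩
        exact hu γ hγ
      · rintro _ ⟨γ, hγ, rfl⟩ _ ⟨γ', hγ', rfl⟩
        have hm : max γ γ' ∈ Ico β α := ⟨le_max_of_le_left hγ.1, max_lt hγ.2 hγ'.2⟩
        exact ⟨u (max γ γ'), ⟨_, hm, rfl⟩, hanti hγ hm (le_max_left _ _),
          hanti hγ' hm (le_max_right _ _)⟩

/-- In a compact Hausdorff semitopological semilattice, a subset that is closed under infima of
nonempty subsets and directed suprema is topologically closed. -/
theorem isClosed_of_isGLB_mem_of_isLUB_mem [CompactSpace Y] [T2Space Y]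
    (hY : ∀ a : Y, Continuous fun x => a ⊓ x) {A : Set Y}
    (hinf : ∀ S ⊆ A, S.Nonempty → ∀ a, IsGLB S a → a ∈ A)
    (hsup : ∀ D ⊆ A, D.Nonempty → DirectedOn (· ≤ ·) D → ∀ a, IsLUB D a → a ∈ A) :
    IsClosed A := by
  refine isClosed_of_closure_subset fun x hx => ?_
  obtain ⟨y, hyA, hy⟩ := exists_mem_forall_mem_of_isClosed_isGδ hY hinf hsup hx
    (fun K : {K : Set Y // IsClosed K ∧ IsGδ K ∧ x ∈ K} => K.1) (fun K => K.2.1)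
    (fun K => K.2.2.1) (fun K => K.2.2.2)
  suffices y = x from this ▸ hyA
  by_contra hne
  obtain ⟨f, hf₀, hf₁, -⟩ := exists_continuous_zero_one_of_isClosed
    (isClosed_singleton (x := x)) (isClosed_singleton (x := y))
    (by simpa using Ne.symm hne)
  have h := hy ⟨f ⁻¹' {0}, isClosed_singleton.preimage f.continuous,
    (isClosed_singleton.isGδ).preimage f.continuous, hf₀ rfl⟩
  have h₁ : f y = 1 := hf₁ rfl
  have h₀ : f y = 0 := h
  simp [h₁] at h₀

theorem ScottOpen.isOpen [CompactSpace Y] [T2Space Y]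
    (hY : ∀ a : Y, Continuous fun x => a ⊓ x) {U : Set Y} (hU : ScottOpen Y U) : IsOpen U := by
  rw [← isClosed_compl_iff]
  refine isClosed_of_isGLB_mem_of_isLUB_mem hY (fun S hS hne a ha haU => ?_)
    fun D hD hne hdir a ha haU => ?_
  · obtain ⟨b, hb⟩ := hne
    exact hS hb (hU.1 (ha.1 hb) haU)
  · obtain ⟨b, hb, hbU⟩ := hU.2 D hne hdir a ha haU
    exact hD hb hbU

theorem isClosed_le_of_shift [CompactSpace Y] [T2Space Y]
    (hY : ∀ a : Y, Continuous fun x => a ⊓ x) : IsClosed {p : Y × Y | p.1 ≤ p.2} := by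
  refine isClosed_of_isGLB_mem_of_isLUB_mem
    (fun p => ((hY p.1).comp continuous_fst).prodMk ((hY p.2).comp continuous_snd))
    (fun S hS _ a ha => ?_) fun D hD _ _ a ha => ?_
  · rw [isGLB_prod] at ha
    refine ha.2.2 ?_
    rintro _ ⟨p, hp, rfl⟩
    exact (ha.1.1 ⟨p, hp, rfl⟩).trans (hS hp)
  · rw [isLUB_prod] at ha
    refine ha.1.2 ?_
    rintro _ ⟨p, hp, rfl⟩
    exact (hD hp : p.1 ≤ p.2).trans (ha.2.1 ⟨p, hp, rfl⟩)

theorem exists_isOpen_isUpperSet_disjoint [CompactSpace Y] [T2Space Y]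
    (hY : ∀ a : Y, Continuous fun x => a ⊓ x) {x y : Y} (h : ¬ x ≤ y) :
    ∃ U V : Set Y, IsOpen U ∧ IsUpperSet U ∧ IsOpen V ∧ x ∈ U ∧ y ∈ V ∧ Disjoint U V := by
  have : OrderClosedTopology Y := ⟨isClosed_le_of_shift hY⟩
  obtain ⟨O, L, hO, hL, hxO, hyL, hOL⟩ := isOpen_prod_iff.1
    (isClosed_le_of_shift hY).isOpen_compl x y h
  obtain ⟨N, hN, hNc, hNL⟩ := exists_mem_nhds_isClosed_subset (hL.mem_nhds hyL)
  have hlow : IsClosed (lowerClosure N : Set Y) := by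
    have : (lowerClosure N : Set Y) = Prod.fst '' ({p : Y × Y | p.1 ≤ p.2} ∩ Prod.snd ⁻¹' N) := by
      ext z
      simp [mem_lowerClosure, and_comm]
    rw [this]
    exact (((isClosed_le_of_shift hY).inter (hNc.preimage continuous_snd)).isCompact.image
      continuous_fst).isClosed
  refine ⟨(lowerClosure N : Set Y)ᶜ, interior N, hlow.isOpen_compl, (lowerClosure N).lower.compl,
    isOpen_interior, ?_, mem_interior_iff_mem_nhds.2 hN, ?_⟩
  · rintro ⟨z, hz, hxz⟩
    exact hOL (mk_mem_prod hxO (hNL hz)) hxz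
  · exact disjoint_compl_left_iff_subset.2 (interior_subset.trans subset_lowerClosure)

end CompleteSubsemilattice

section WayBelow

variable {Y : Type*} [SemilatticeInf Y] [TopologicalSpace Y]

theorem IsUpperSet.interior_of_shift (hY : ∀ a : Y, Continuous fun x => a ⊓ x) {U : Set Y}
    (hU : IsUpperSet U) : IsUpperSet (interior U) := by
  intro a b hab ha
  refine mem_interior.2 ⟨(fun x => a ⊓ x) ⁻¹' interior U, fun z hz => ?_,
    isOpen_interior.preimage (hY a), ?_⟩
  · exact hU inf_le_right (interior_subset hz)
  · simpa [inf_eq_left.2 hab] using ha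

theorem exists_mem_interior_Ici_of_finite (hY : ∀ a : Y, Continuous fun x => a ⊓ x) {F : Set Y}
    (hF : F.Finite) {x : Y} (h : x ∈ interior (⋃ y ∈ F, Ici y)) :
    ∃ v ∈ F, x ∈ interior (Ici v) := by
  by_contra! hcon
  have key : ∀ U : Set Y, IsOpen U → x ∈ U → ∃ y ∈ U, y ≤ x ∧ ∀ f ∈ F, ¬ f ≤ y := by
    clear h
    induction F, hF using Set.Finite.induction_on with
    | empty => exact fun U _ hx => ⟨x, hx, le_rfl, by simp⟩
    | @insert f F _ _ ih =>
      intro U hU hx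
      obtain ⟨y, hyU, hyx, hy⟩ := ih (fun v hv => hcon v (mem_insert_of_mem _ hv)) U hU hx
      have hnot : ¬ (fun z => y ⊓ z) ⁻¹' U ⊆ Ici f := fun hsub =>
        hcon f (mem_insert _ _) (mem_interior.2 ⟨_, hsub, hU.preimage (hY y), by
          simpa [inf_eq_left.2 hyx] using hyU⟩)
      obtain ⟨z, hzU, hz⟩ := not_subset.1 hnot
      refine ⟨y ⊓ z, hzU, inf_le_left.trans hyx, ?_⟩
      rintro g (rfl | hg) hle
      · exact hz (hle.trans inf_le_right)
      · exact hy g hg (hle.trans inf_le_left)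
  obtain ⟨y, hy, -, hyF⟩ := key _ isOpen_interior h
  obtain ⟨f, hf, hfy⟩ := mem_iUnion₂.1 (interior_subset hy)
  exact hyF f hf hfy

theorem nonempty_and_directedOn_setOf_mem_interior_Ici [CompactSpace Y] [T2Space Y]
    (hY : ∀ a : Y, Continuous fun x => a ⊓ x) (x : Y) :
    {v | x ∈ interior (Ici v)}.Nonempty ∧
      DirectedOn (· ≤ ·) {v | x ∈ interior (Ici v)} := by
  constructor
  · obtain ⟨b, hb⟩ := exists_isGLB_of_nonempty hY (⟨x, mem_univ x⟩ : (univ : Set Y).Nonempty)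
    have : Ici b = univ := eq_univ_of_forall fun z => hb.1 (mem_univ z)
    exact ⟨b, by simp [this]⟩
  · intro v hv w hw
    have hx : x ∈ interior (Ici v ∩ Ici w) := by
      rw [interior_inter]
      exact ⟨hv, hw⟩
    obtain ⟨m, hm⟩ := exists_isGLB_of_nonempty hY ⟨x, interior_subset hx⟩
    exact ⟨m, interior_mono (fun z hz => hm.1 hz) hx, hm.2 fun z hz => hz.1,
      hm.2 fun z hz => hz.2⟩

theorem exists_mem_mem_interior_Ici [CompactSpace Y] [T2Space Y]
    (hY : ∀ a : Y, Continuous fun x => a ⊓ x)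
    (hV : ∀ x y : Y, ¬ x ≤ y → ∃ v, v ∉ Iic y ∧ x ∈ interior (Ici v)) {V : Set Y}
    (hVo : IsOpen V) {x : Y} (hx : x ∈ V) : ∃ v ∈ V, x ∈ interior (Ici v) := by
  obtain ⟨hne, hdir⟩ := nonempty_and_directedOn_setOf_mem_interior_Ici hY x
  have hlub : IsLUB {v | x ∈ interior (Ici v)} x := by
    refine ⟨fun v hv => interior_subset hv, fun b hb => ?_⟩
    by_contra h
    obtain ⟨v, hvb, hv⟩ := hV x b h
    exact hvb (hb hv)
  obtain ⟨v, hv, hvx⟩ := mem_closure_iff.1 (hlub.mem_closure_of_shift hY hne hdir) V hVo hx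
  exact ⟨v, hv, hvx⟩

theorem exists_isOpen_filter [CompactSpace Y] [T2Space Y]
    (hY : ∀ a : Y, Continuous fun x => a ⊓ x)
    (hU : ∀ V : Set Y, IsOpen V → ∀ x ∈ V, ∃ v ∈ V, x ∈ interior (Ici v)) {p q : Y}
    (h : p ∈ interior (Ici q)) :
    ∃ v : Set Y, IsOpen v ∧ (∀ z w, z ⊓ w ∈ v ↔ z ∈ v ∧ w ∈ v) ∧ p ∈ v ∧ v ⊆ Ici q := by
  have hstep : ∀ r : {r // r ∈ interior (Ici q)}, ∃ r' : {r // r ∈ interior (Ici q)},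
      r.1 ∈ interior (Ici r'.1) := fun r => by
    obtain ⟨v, hv, hrv⟩ := hU _ isOpen_interior r.1 r.2
    exact ⟨⟨v, hv⟩, hrv⟩
  choose g hg using hstep
  let r : ℕ → {r // r ∈ interior (Ici q)} := fun n => g^[n] ⟨p, h⟩
  have hr : ∀ n, (r n).1 ∈ interior (Ici (r (n + 1)).1) := fun n => by
    simp only [r, Function.iterate_succ_apply']
    exact hg _
  have hanti : Antitone fun n => (r n).1 := antitone_nat_of_succ_le fun n => interior_subset (hr n)
  refine ⟨⋃ n, Ici (r n).1, isOpen_iff_forall_mem_open.2 fun z hz => ?_, fun z w => ?_, ?_, ?_⟩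
  · obtain ⟨n, hn⟩ := mem_iUnion.1 hz
    exact ⟨interior (Ici (r (n + 1)).1),
      interior_subset.trans (subset_iUnion (fun n => Ici (r n).1) (n + 1)),
      isOpen_interior, (isUpperSet_Ici _).interior_of_shift hY hn (hr n)⟩
  · simp only [mem_iUnion, mem_Ici]
    constructor
    · rintro ⟨n, hn⟩
      exact ⟨⟨n, hn.trans inf_le_left⟩, ⟨n, hn.trans inf_le_right⟩⟩
    · rintro ⟨⟨n, hn⟩, ⟨m, hm⟩⟩
      exact ⟨max n m, le_inf ((hanti (le_max_left n m)).trans hn)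
        ((hanti (le_max_right n m)).trans hm)⟩
  · exact mem_iUnion.2 ⟨0, le_rfl⟩
  · exact iUnion_subset fun n => Ici_subset_Ici.2 (interior_subset (r n).2)

theorem Urysohns.CU.approx_inf {P : Set Y → Set Y → Prop}
    (hP : ∀ C U, P C U → ∀ z w, z ⊓ w ∈ U ↔ z ∈ U ∧ w ∈ U) (n : ℕ) (c : Urysohns.CU P)
    (a b : Y) : c.approx n (a ⊓ b) = max (c.approx n a) (c.approx n b) := by
  induction n generalizing c with
  | zero =>
    have h := hP _ _ c.P_C_U a b
    by_cases ha : a ∈ c.U <;> by_cases hb : b ∈ c.U <;> simp [approx, indicator, h, ha, hb]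
  | succ n ih =>
    have hor : ∀ z, c.right.approx n z = 0 ∨ c.left.approx n z = 1 := fun z => by
      by_cases hz : z ∈ c.left.U
      · exact .inl (c.right.approx_of_mem_C n (c.left_U_subset_right_C hz))
      · exact .inr (c.left.approx_of_notMem_U n hz)
    simp only [approx, ih, midpoint_eq_smul_add, invOf_eq_inv, smul_eq_mul]
    have ha₀ := c.right.approx_nonneg n a
    have hb₀ := c.right.approx_nonneg n b
    have ha₁ := c.left.approx_le_one n a
    have hb₁ := c.left.approx_le_one n b
    rcases le_total (c.left.approx n a) (c.left.approx n b) with hl | hl <;>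
    rcases le_total (c.right.approx n a) (c.right.approx n b) with hr | hr <;>
    rcases hor a with ha | ha <;> rcases hor b with hb | hb <;>
    simp only [max_def] <;> split_ifs <;> linarith

theorem exists_continuous_inf_hom_ne [CompactSpace Y] [T2Space Y]
    (hY : ∀ a : Y, Continuous fun x => a ⊓ x)
    (hU : ∀ V : Set Y, IsOpen V → ∀ x ∈ V, ∃ v ∈ V, x ∈ interior (Ici v)) {x y : Y}
    (hxy : ¬ x ≤ y) : ∃ h : Y → unitInterval, Continuous h ∧
      (∀ a b : Y, h (a ⊓ b) = min (h a) (h b)) ∧ h x ≠ h y := by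
  let P : Set Y → Set Y → Prop := fun c u =>
    (∀ z w, z ⊓ w ∈ u ↔ z ∈ u ∧ w ∈ u) ∧ ∃ p ∈ u, c ⊆ Ici p
  obtain ⟨q, hq, hxq⟩ := hU (Iic y)ᶜ (isClosed_Iic_of_shift hY y).isOpen_compl x hxy
  obtain ⟨u, huo, huf, hxu, huq⟩ := exists_isOpen_filter hY hU hxq
  have hup : ∀ {u : Set Y}, (∀ z w, z ⊓ w ∈ u ↔ z ∈ u ∧ w ∈ u) → ∀ {p}, p ∈ u → Ici p ⊆ u :=
    fun hu p hp z hz => ((hu p z).1 (by rwa [inf_eq_left.2 hz])).2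
  let c : Urysohns.CU P :=
    { C := Ici x
      U := u
      P_C_U := ⟨huf, x, hxu, subset_rfl⟩
      closed_C := isClosed_Ici_of_shift hY x
      open_U := huo
      subset := hup huf hxu
      hP := by
        rintro c u - ⟨hu, p, hpu, hcp⟩ huo -
        obtain ⟨q, hqu, hpq⟩ := hU u huo p hpu
        obtain ⟨v, hvo, hvf, hpv, hvq⟩ := exists_isOpen_filter hY hU hpq
        have hvc : closure v ⊆ Ici q := closure_minimal hvq (isClosed_Ici_of_shift hY q)
        exact ⟨v, hvo, hcp.trans (hup hvf hpv), hvc.trans (hup hu hqu), ⟨hvf, p, hpv, hcp⟩,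
          hu, q, hqu, hvc⟩ }
  have hlim : ∀ a b, c.lim (a ⊓ b) = max (c.lim a) (c.lim b) := fun a b =>
    tendsto_nhds_unique (c.tendsto_approx_atTop _) (by
      simp only [Urysohns.CU.approx_inf (P := P) (fun _ _ h => h.1)]
      exact (c.tendsto_approx_atTop a).max (c.tendsto_approx_atTop b))
  refine ⟨fun z => unitInterval.symm ⟨c.lim z, c.lim_mem_Icc z⟩,
    unitInterval.continuous_symm.comp (c.continuous_lim.subtype_mk _), fun a b => ?_, ?_⟩
  · rcases le_total (c.lim a) (c.lim b) with h | h
    · rw [min_eq_right (unitInterval.symm_le_symm.2 (Subtype.mk_le_mk.2 h))]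
      simp [hlim, h]
    · rw [min_eq_left (unitInterval.symm_le_symm.2 (Subtype.mk_le_mk.2 h))]
      simp [hlim, h]
  · have hx : c.lim x = 0 := c.lim_of_mem_C x self_mem_Ici
    have hy : c.lim y = 1 := c.lim_of_notMem_U y fun hyu => hq (huq hyu)
    simp [hx, hy]

end WayBelow

section WeakTopologies

open scoped Topology

variable {Y : Type*}

theorem TopologicalSpace.eq_of_le_of_compactSpace_of_t2Space {t t' : TopologicalSpace Y}
    (ht : @CompactSpace Y t) (ht' : @T2Space Y t') (h : t ≤ t') : t' = t :=
  le_antisymm (continuous_id_iff_le.1 (@Continuous.continuous_symm_of_equiv_compact_to_t2 _ _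
    t t' ht ht' (Equiv.refl Y) (continuous_id_iff_le.2 h))) h

variable [SemilatticeInf Y] [t : TopologicalSpace Y]

theorem le_iweakTop : t ≤ iweakTop Y := by
  refine le_generateFrom ?_
  rintro _ ⟨h, hc, -, U, hU, rfl⟩
  exact hU.preimage hc

theorem le_etaTop : t ≤ etaTop Y :=
  le_generateFrom fun _ h => h.1

theorem le_zarTop : t ≤ zarTop Y := by
  refine le_generateFrom ?_
  rintro _ ⟨S, hS, -, rfl⟩
  exact hS.isOpen_compl

theorem le_lawsonTop [CompactSpace Y] [T2Space Y] (hY : ∀ a : Y, Continuous fun x => a ⊓ x) :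
    t ≤ lawsonTop Y := by
  refine le_generateFrom ?_
  rintro _ (hU | ⟨x, rfl⟩)
  · exact hU.isOpen hY
  · exact (isClosed_Ici_of_shift hY x).isOpen_compl

theorem etaTop_le_iweakTop : etaTop Y ≤ iweakTop Y := by
  refine le_generateFrom ?_
  rintro _ ⟨h, hc, hh, U, hU, rfl⟩
  refine @IsOpen.preimage Y unitInterval (etaTop Y) _ h ?_ U hU
  refine (@OrderTopology.continuous_iff unitInterval Y _ _ _ (etaTop Y) h).2 fun a => ⟨?_, ?_⟩
  · refine isOpen_generateFrom_of_mem ⟨isOpen_Ioi.preimage hc, fun b hb c hc => ?_⟩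
    rw [mem_preimage, mem_Ioi, hh]
    exact lt_min hb hc
  · refine isOpen_generateFrom_of_mem ⟨isOpen_Iio.preimage hc, fun b hb c hc => ?_⟩
    rw [mem_preimage, mem_Iio, hh]
    exact (min_le_left _ _).trans_lt hb

theorem zarTop_le_iweakTop : zarTop Y ≤ iweakTop Y := by
  refine le_generateFrom ?_
  rintro _ ⟨h, hc, hh, U, hU, rfl⟩
  refine @IsOpen.preimage Y unitInterval (zarTop Y) _ h ?_ U hU
  refine (@OrderTopology.continuous_iff unitInterval Y _ _ _ (zarTop Y) h).2 fun a => ⟨?_, ?_⟩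
  · refine isOpen_generateFrom_of_mem ⟨h ⁻¹' Iic a, isClosed_Iic.preimage hc,
      fun b hb c hc => ?_, by rw [← preimage_compl, compl_Iic]⟩
    rw [mem_preimage, mem_Iic, hh]
    exact (min_le_left _ _).trans hb
  · refine isOpen_generateFrom_of_mem ⟨h ⁻¹' Ici a, isClosed_Ici.preimage hc,
      fun b hb c hc => ?_, by rw [← preimage_compl, compl_Ici]⟩
    rw [mem_preimage, mem_Ici, hh]
    exact le_min hb hc

theorem exists_infClosed_subset_of_isOpen_etaTop {O : Set Y} (hO : IsOpen[etaTop Y] O) {x : Y}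
    (hx : x ∈ O) : ∃ S, IsOpen S ∧ InfClosed S ∧ x ∈ S ∧ S ⊆ O := by
  induction hO with
  | basic s hs => exact ⟨s, hs.1, fun a ha b hb => hs.2 a ha b hb, hx, subset_rfl⟩
  | univ => exact ⟨univ, isOpen_univ, infClosed_univ, hx, subset_rfl⟩
  | inter s u _ _ ihs ihu =>
    obtain ⟨S, hSo, hS, hxS, hSs⟩ := ihs hx.1
    obtain ⟨U, hUo, hU, hxU, hUu⟩ := ihu hx.2
    exact ⟨S ∩ U, hSo.inter hUo, hS.inter hU, ⟨hxS, hxU⟩, inter_subset_inter hSs hUu⟩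
  | sUnion 𝒮 _ ih =>
    obtain ⟨s, hs, hxs⟩ := hx
    obtain ⟨S, hSo, hS, hxS, hSs⟩ := ih s hs hxs
    exact ⟨S, hSo, hS, hxS, hSs.trans (subset_sUnion_of_mem hs)⟩

theorem exists_finite_compl_subset_of_isOpen_zarTop {O : Set Y} (hO : IsOpen[zarTop Y] O) {x : Y}
    (hx : x ∈ O) : ∃ 𝒜 : Set (Set Y), 𝒜.Finite ∧ (∀ A ∈ 𝒜, IsClosed A ∧ InfClosed A) ∧
      x ∉ ⋃₀ 𝒜 ∧ Oᶜ ⊆ ⋃₀ 𝒜 := by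
  induction hO with
  | basic s hs =>
    obtain ⟨S, hSc, hS, rfl⟩ := hs
    exact ⟨{S}, finite_singleton S, by
      rintro _ rfl
      exact ⟨hSc, fun a ha b hb => hS a ha b hb⟩, by simpa using hx, by simp⟩
  | univ => exact ⟨∅, finite_empty, by simp, by simp, by simp⟩
  | inter s u _ _ ihs ihu =>
    obtain ⟨𝒜, h𝒜f, h𝒜, hx𝒜, h𝒜s⟩ := ihs hx.1
    obtain ⟨ℬ, hℬf, hℬ, hxℬ, hℬu⟩ := ihu hx.2
    refine ⟨𝒜 ∪ ℬ, h𝒜f.union hℬf, ?_, ?_, ?_⟩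
    · rintro A (hA | hA)
      exacts [h𝒜 A hA, hℬ A hA]
    · rw [sUnion_union]
      exact fun h => h.elim hx𝒜 hxℬ
    · rw [sUnion_union, compl_inter]
      exact union_subset_union h𝒜s hℬu
  | sUnion 𝒮 _ ih =>
    obtain ⟨s, hs, hxs⟩ := hx
    obtain ⟨𝒜, h𝒜f, h𝒜, hx𝒜, h𝒜s⟩ := ih s hs hxs
    exact ⟨𝒜, h𝒜f, h𝒜, hx𝒜, (compl_subset_compl.2 (subset_sUnion_of_mem hs)).trans h𝒜s⟩

theorem exists_diff_subset_of_isOpen_lawsonTop [CompactSpace Y] [T2Space Y]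
    (hY : ∀ a : Y, Continuous fun x => a ⊓ x) {O : Set Y} (hO : IsOpen[lawsonTop Y] O) {x : Y}
    (hx : x ∈ O) : ∃ S F : Set Y, IsOpen S ∧ IsUpperSet S ∧ F.Finite ∧ x ∈ S ∧
      (∀ f ∈ F, ¬ f ≤ x) ∧ S \ ⋃ f ∈ F, Ici f ⊆ O := by
  induction hO with
  | basic s hs =>
    rcases hs with hs | ⟨f, rfl⟩
    · exact ⟨s, ∅, hs.isOpen hY, hs.1, finite_empty, hx, by simp, by simp⟩
    · exact ⟨univ, {f}, isOpen_univ, isUpperSet_univ, finite_singleton f, mem_univ x,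
        by simpa using hx, by simp [compl_eq_univ_sdiff]⟩
  | univ => exact ⟨univ, ∅, isOpen_univ, isUpperSet_univ, finite_empty, hx, by simp, by simp⟩
  | inter s u _ _ ihs ihu =>
    obtain ⟨S, F, hSo, hS, hF, hxS, hxF, hSF⟩ := ihs hx.1
    obtain ⟨U, G, hUo, hU, hG, hxU, hxG, hUG⟩ := ihu hx.2
    refine ⟨S ∩ U, F ∪ G, hSo.inter hUo, hS.inter hU, hF.union hG, ⟨hxS, hxU⟩, ?_, ?_⟩
    · rintro f (hf | hf)
      exacts [hxF f hf, hxG f hf]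
    · rw [biUnion_union]
      exact fun z hz => ⟨hSF ⟨hz.1.1, fun h => hz.2 (.inl h)⟩,
        hUG ⟨hz.1.2, fun h => hz.2 (.inr h)⟩⟩
  | sUnion 𝒮 _ ih =>
    obtain ⟨s, hs, hxs⟩ := hx
    obtain ⟨S, F, hSo, hS, hF, hxS, hxF, hSF⟩ := ih s hs hxs
    exact ⟨S, F, hSo, hS, hF, hxS, hxF, hSF.trans (subset_sUnion_of_mem hs)⟩

variable [CompactSpace Y] [T2Space Y]

theorem IsUpperSet.scottOpen_of_isOpen (hY : ∀ a : Y, Continuous fun x => a ⊓ x) {U : Set Y}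
    (hU : IsUpperSet U) (hUo : IsOpen U) : ScottOpen Y U := by
  refine ⟨hU, fun D hne hD a ha haU => ?_⟩
  rw [inter_comm]
  exact mem_closure_iff.1 (ha.mem_closure_of_shift hY hne hD) U hUo haU

theorem IsUpperSet.isOpen_lawsonTop (hY : ∀ a : Y, Continuous fun x => a ⊓ x) {U : Set Y}
    (hU : IsUpperSet U) (hUo : IsOpen U) : IsOpen[lawsonTop Y] U :=
  isOpen_generateFrom_of_mem (.inl (hU.scottOpen_of_isOpen hY hUo))

theorem exists_mem_interior_Ici_of_etaTop (hY : ∀ a : Y, Continuous fun x => a ⊓ x) {x y : Y}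
    (H : ∀ p, ¬ x ≤ p → ∃ Ox Op : Set Y, IsOpen[etaTop Y] Ox ∧ IsOpen Op ∧
      x ∈ Ox ∧ p ∈ Op ∧ Disjoint Ox Op) (hxy : ¬ x ≤ y) :
    ∃ v, v ∉ Iic y ∧ x ∈ interior (Ici v) := by
  obtain ⟨S, hSo, hS, hxS, O, hO, hyO, hSO⟩ :=
    (isClosed_Iic_of_shift hY y).isCompact.induction_on
      (p := fun s => ∃ S, IsOpen S ∧ InfClosed S ∧ x ∈ S ∧ ∃ O, IsOpen O ∧ s ⊆ O ∧ Disjoint S O)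
      ⟨univ, isOpen_univ, infClosed_univ, mem_univ x, ∅, isOpen_empty, subset_rfl,
        disjoint_empty _⟩
      (fun s u hsu ⟨S, hSo, hS, hxS, O, hO, huO, hSO⟩ =>
        ⟨S, hSo, hS, hxS, O, hO, hsu.trans huO, hSO⟩)
      (fun s u ⟨S, hSo, hS, hxS, O, hO, hsO, hSO⟩ ⟨S', hSo', hS', hxS', O', hO', huO', hSO'⟩ =>
        ⟨S ∩ S', hSo.inter hSo', hS.inter hS', ⟨hxS, hxS'⟩, O ∪ O', hO.union hO',
          union_subset_union hsO huO', disjoint_union_right.2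
            ⟨hSO.mono_left inter_subset_left, hSO'.mono_left inter_subset_right⟩⟩)
      (fun p hp => by
        obtain ⟨Ox, Op, hOx, hOp, hx, hpO, hd⟩ := H p fun h => hxy (h.trans hp)
        obtain ⟨S, hSo, hS, hxS, hSO⟩ := exists_infClosed_subset_of_isOpen_etaTop hOx hx
        exact ⟨Op, mem_nhdsWithin_of_mem_nhds (hOp.mem_nhds hpO), S, hSo, hS, hxS, Op, hOp,
          subset_rfl, hd.mono_left hSO⟩)
  obtain ⟨m, hm⟩ := (hS.closure_of_shift hY).exists_isLeast hY isClosed_closure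
    ⟨x, subset_closure hxS⟩
  refine ⟨m, fun hmy => ?_, mem_interior.2 ⟨S, fun z hz => hm.2 (subset_closure hz), hSo, hxS⟩⟩
  exact (hSO.closure_left hO).le_bot ⟨hm.1, hyO hmy⟩

theorem exists_mem_interior_Ici_of_zarTop (hY : ∀ a : Y, Continuous fun x => a ⊓ x) {x y : Y}
    (H : ∀ p, ¬ x ≤ p → ∃ Op Ox : Set Y, IsOpen[zarTop Y] Op ∧ IsOpen Ox ∧
      p ∈ Op ∧ x ∈ Ox ∧ Disjoint Op Ox) (hxy : ¬ x ≤ y) :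
    ∃ v, v ∉ Iic y ∧ x ∈ interior (Ici v) := by
  obtain ⟨𝒜, h𝒜f, h𝒜, hx𝒜, hd⟩ :=
    (isClosed_Iic_of_shift hY y).isCompact.induction_on
      (p := fun s => ∃ 𝒜 : Set (Set Y), 𝒜.Finite ∧ (∀ A ∈ 𝒜, IsClosed A ∧ InfClosed A) ∧
        ⋃₀ 𝒜 ∈ nhds x ∧ Disjoint (⋃₀ 𝒜) s)
      ⟨{univ}, finite_singleton _, by
        rintro _ rfl
        exact ⟨isClosed_univ, infClosed_univ⟩, by simp, disjoint_empty _⟩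
      (fun s u hsu ⟨𝒜, h𝒜f, h𝒜, hx𝒜, hd⟩ => ⟨𝒜, h𝒜f, h𝒜, hx𝒜, hd.mono_right hsu⟩)
      (fun s u ⟨𝒜, h𝒜f, h𝒜, hx𝒜, hd⟩ ⟨ℬ, hℬf, hℬ, hxℬ, hd'⟩ => by
        have hsub : ⋃₀ image2 (· ∩ ·) 𝒜 ℬ = ⋃₀ 𝒜 ∩ ⋃₀ ℬ := by
          ext z
          simp only [mem_sUnion, mem_image2, mem_inter_iff]
          constructor
          · rintro ⟨_, ⟨A, hA, B, hB, rfl⟩, hz⟩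
            exact ⟨⟨A, hA, hz.1⟩, B, hB, hz.2⟩
          · rintro ⟨⟨A, hA, hzA⟩, B, hB, hzB⟩
            exact ⟨_, ⟨A, hA, B, hB, rfl⟩, hzA, hzB⟩
        refine ⟨image2 (· ∩ ·) 𝒜 ℬ, h𝒜f.image2 _ hℬf, ?_, ?_, ?_⟩
        · rintro _ ⟨A, hA, B, hB, rfl⟩
          exact ⟨(h𝒜 A hA).1.inter (hℬ B hB).1, (h𝒜 A hA).2.inter (hℬ B hB).2⟩
        · rw [hsub]
          exact Filter.inter_mem hx𝒜 hxℬ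
        · rw [hsub]
          exact disjoint_union_right.2
            ⟨hd.mono_left inter_subset_left, hd'.mono_left inter_subset_right⟩)
      (fun p hp => by
        obtain ⟨Op, Ox, hOp, hOx, hpO, hx, hd⟩ := H p fun h => hxy (h.trans hp)
        obtain ⟨𝒜, h𝒜f, h𝒜, hp𝒜, hO𝒜⟩ := exists_finite_compl_subset_of_isOpen_zarTop hOp hpO
        have hc : IsClosed (⋃₀ 𝒜) := by
          rw [sUnion_eq_biUnion]
          exact h𝒜f.isClosed_biUnion fun A hA => (h𝒜 A hA).1
        exact ⟨(⋃₀ 𝒜)ᶜ, mem_nhdsWithin_of_mem_nhds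
            (hc.isOpen_compl.mem_nhds hp𝒜),
          𝒜, h𝒜f, h𝒜, Filter.mem_of_superset (hOx.mem_nhds hx)
            (hd.subset_compl_left.trans hO𝒜), disjoint_compl_right⟩)
  let F : Set Y := {m | ∃ A ∈ 𝒜, IsLeast A m}
  have hF : F.Finite := (h𝒜f.biUnion (t := fun A => {m | IsLeast A m}) fun A _ =>
    (Subsingleton.finite fun m hm n hn => IsLeast.unique hm hn)).subset
      fun m ⟨A, hA, hm⟩ => mem_biUnion hA hm
  obtain ⟨v, ⟨A, hA, hv⟩, hxv⟩ := exists_mem_interior_Ici_of_finite hY hF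
    (mem_interior_iff_mem_nhds.2 (Filter.mem_of_superset hx𝒜 fun z ⟨A, hA, hz⟩ => by
      obtain ⟨m, hm⟩ := (h𝒜 A hA).2.exists_isLeast hY (h𝒜 A hA).1 ⟨z, hz⟩
      exact mem_biUnion (show m ∈ F from ⟨A, hA, hm⟩) (hm.2 hz)))
  exact ⟨v, fun hvy => hd.le_bot ⟨⟨A, hA, hv.1⟩, hvy⟩, hxv⟩

theorem exists_mem_interior_Ici_of_lawsonTop (hY : ∀ a : Y, Continuous fun x => a ⊓ x)
    (H : @T2Space Y (lawsonTop Y)) {x y : Y} (hxy : ¬ x ≤ y) :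
    ∃ v, v ∉ Iic y ∧ x ∈ interior (Ici v) := by
  by_contra! hcon
  obtain ⟨hne, hdir⟩ := nonempty_and_directedOn_setOf_mem_interior_Ici hY x
  obtain ⟨a, -, ha⟩ := exists_isLUB_mem_closure hY hne hdir
  have hax : a ≤ x := ha.2 fun v hv => interior_subset hv
  have hay : a ≤ y := ha.2 fun v hv => by_contra fun h => hcon v h hv
  have hne : x ≠ a := by
    rintro rfl
    exact hxy hay
  obtain ⟨O, O', hO, hO', hxO, haO', hd⟩ := @t2_separation Y (lawsonTop Y) H x a hne
  obtain ⟨S, F, hSo, -, hF, hxS, hxF, hSF⟩ := exists_diff_subset_of_isOpen_lawsonTop hY hO hxO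
  obtain ⟨T, G, hTo, hT, hG, haT, haG, hTG⟩ :=
    exists_diff_subset_of_isOpen_lawsonTop hY hO' haO'
  obtain ⟨g, hg, hxg⟩ := exists_mem_interior_Ici_of_finite hY hG (x := x) (mem_interior.2
    ⟨(S ∩ T) \ ⋃ f ∈ F, Ici f, fun z hz => by_contra fun h =>
        hd.le_bot ⟨hSF ⟨hz.1.1, hz.2⟩, hTG ⟨hz.1.2, h⟩⟩,
      (hSo.inter hTo).sdiff (hF.isClosed_biUnion fun f _ => isClosed_Ici_of_shift hY f),
      ⟨hxS, hT hax haT⟩, by simpa using hxF⟩)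
  exact haG g hg (ha.1 hxg)

theorem t2Space_lawsonTop (hY : ∀ a : Y, Continuous fun x => a ⊓ x)
    (hV : ∀ x y : Y, ¬ x ≤ y → ∃ v, v ∉ Iic y ∧ x ∈ interior (Ici v)) :
    @T2Space Y (lawsonTop Y) := by
  have key : ∀ x y : Y, ¬ x ≤ y → ∃ U V, IsOpen[lawsonTop Y] U ∧ IsOpen[lawsonTop Y] V ∧
      x ∈ U ∧ y ∈ V ∧ Disjoint U V := fun x y h => by
    obtain ⟨v, hvy, hxv⟩ := hV x y h
    exact ⟨interior (Ici v), (Ici v)ᶜ,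
      ((isUpperSet_Ici v).interior_of_shift hY).isOpen_lawsonTop hY isOpen_interior,
      isOpen_generateFrom_of_mem (.inr ⟨v, rfl⟩), hxv, hvy,
      disjoint_compl_right.mono_left interior_subset⟩
  refine @T2Space.mk Y (lawsonTop Y) fun x y hxy => ?_
  by_cases h : x ≤ y
  · obtain ⟨U, V, hU, hV, hyU, hxV, hd⟩ := key y x fun h' => hxy (h.antisymm h')
    exact ⟨V, U, hV, hU, hxV, hyU, hd.symm⟩
  · exact key x y h

theorem t2Space_iweakTop {Z : Type*} [SemilatticeInf Z] [TopologicalSpace Z]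
    (H : ∀ x y : Z, x ≠ y → ∃ h : Z → unitInterval, Continuous h ∧
      (∀ a b : Z, h (a ⊓ b) = min (h a) (h b)) ∧ h x ≠ h y) : @T2Space Z (iweakTop Z) := by
  refine @T2Space.mk Z (iweakTop Z) fun x y hxy => ?_
  obtain ⟨h, hc, hh, hne⟩ := H x y hxy
  obtain ⟨U, V, hU, hV, hx, hy, hd⟩ := t2_separation hne
  exact ⟨h ⁻¹' U, h ⁻¹' V, isOpen_generateFrom_of_mem ⟨h, hc, hh, U, hU, rfl⟩,
    isOpen_generateFrom_of_mem ⟨h, hc, hh, V, hV, rfl⟩, hx, hy, hd.preimage h⟩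

end WeakTopologies

/-- For a compact Hausdorff semitopological semilattice `X` with topology
`τ_X` fifteen conditions are equivalent, among them: `𝒲_X = τ_X`, `η_X = τ_X`,
`𝒵_X = τ_X`, `𝒲_X = Λ_X`, `Λ_X ⊆ η_X`, Hausdorffness of `η_X`, `𝒵_X`, `𝒲_X`, `Λ_X`,
`ητ`- and `𝒵τ`-separatedness, `𝕀`-separatedness, and being a W-, U-, V-semilattice. -/
theorem stmt18 {X : Type*} [SemilatticeInf X] [t : TopologicalSpace X]
    [CompactSpace X] [T2Space X]
    (hsemi : ∀ a : X, Continuous fun x => a ⊓ x) :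
    List.TFAE
      [iweakTop X = t,
       etaTop X = t,
       zarTop X = t,
       iweakTop X = lawsonTop X,
       ∀ U : Set X, @IsOpen X (lawsonTop X) U → @IsOpen X (etaTop X) U,
       @T2Space X (etaTop X),
       @T2Space X (zarTop X),
       @T2Space X (iweakTop X),
       @T2Space X (lawsonTop X),
       ∀ x y : X, x ≠ y → ∃ Ox Oy : Set X, @IsOpen X (etaTop X) Ox ∧ IsOpen Oy ∧
         x ∈ Ox ∧ y ∈ Oy ∧ Disjoint Ox Oy,
       ∀ x y : X, x ≠ y → ∃ Ox Oy : Set X, @IsOpen X (zarTop X) Ox ∧ IsOpen Oy ∧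
         x ∈ Ox ∧ y ∈ Oy ∧ Disjoint Ox Oy,
       ∀ x y : X, x ≠ y → ∃ h : X → unitInterval, Continuous h ∧
         (∀ a b : X, h (a ⊓ b) = min (h a) (h b)) ∧ h x ≠ h y,
       ∀ V : Set X, IsOpen V → ∀ x ∈ V, ∃ F : Finset X, ↑F ⊆ V ∧
         x ∈ interior (⋃ y ∈ F, Set.Ici y),
       ∀ V : Set X, IsOpen V → ∀ x ∈ V, ∃ v ∈ V, x ∈ interior (Set.Ici v),
       ∀ x y : X, ¬ x ≤ y → ∃ v : X, v ∉ Set.Iic y ∧ x ∈ interior (Set.Ici v)] := by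
  have hsep : ∀ {τ : TopologicalSpace X}, t ≤ τ → @T2Space X τ → ∀ x y : X, x ≠ y →
      ∃ Ox Oy : Set X, @IsOpen X τ Ox ∧ @IsOpen X t Oy ∧ x ∈ Ox ∧ y ∈ Oy ∧ Disjoint Ox Oy :=
    fun {τ} hle hτ x y hxy => by
      obtain ⟨U, V, hU, hV, hx, hy, hd⟩ := @t2_separation X τ hτ x y hxy
      exact ⟨U, V, hU, hle V hV, hx, hy, hd⟩
  have hc : CompactSpace X := inferInstance
  have ht : T2Space X := inferInstance
  tfae_have 1 → 2 := fun h => le_antisymm (etaTop_le_iweakTop.trans h.le) le_etaTop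
  tfae_have 1 → 3 := fun h => le_antisymm (zarTop_le_iweakTop.trans h.le) le_zarTop
  tfae_have 2 → 6 := fun h => h.symm ▸ ht
  tfae_have 3 → 7 := fun h => h.symm ▸ ht
  tfae_have 6 → 10 := hsep le_etaTop
  tfae_have 7 → 11 := hsep le_zarTop
  tfae_have 10 → 15 := fun h x y => exists_mem_interior_Ici_of_etaTop hsemi fun p hp =>
    h x p fun hxp => hp hxp.le
  tfae_have 11 → 15 := fun h x y => exists_mem_interior_Ici_of_zarTop hsemi fun p hp =>
    h p x fun hpx => hp hpx.ge
  tfae_have 15 → 14 := fun h V hV x hx => exists_mem_mem_interior_Ici hsemi h hV hx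
  tfae_have 14 → 13 := fun h V hV x hx => by
    obtain ⟨v, hv, hxv⟩ := h V hV x hx
    exact ⟨{v}, by simpa using hv, by simpa using hxv⟩
  tfae_have 13 → 14 := fun h V hV x hx => by
    obtain ⟨F, hFV, hxF⟩ := h V hV x hx
    obtain ⟨v, hv, hxv⟩ := exists_mem_interior_Ici_of_finite hsemi F.finite_toSet hxF
    exact ⟨v, hFV hv, hxv⟩
  tfae_have 14 → 12 := fun h x y hxy => by
    by_cases hle : x ≤ y
    · obtain ⟨f, hf, hhom, hne⟩ :=
        exists_continuous_inf_hom_ne hsemi h fun hle' => hxy (hle.antisymm hle')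
      exact ⟨f, hf, hhom, hne.symm⟩
    · exact exists_continuous_inf_hom_ne hsemi h hle
  tfae_have 12 → 8 := t2Space_iweakTop
  tfae_have 8 → 1 := fun h => eq_of_le_of_compactSpace_of_t2Space hc h le_iweakTop
  tfae_have 15 → 9 := t2Space_lawsonTop hsemi
  tfae_have 9 → 15 := fun h x y => exists_mem_interior_Ici_of_lawsonTop hsemi h
  tfae_have 1 → 4 := fun h => h.trans (eq_of_le_of_compactSpace_of_t2Space hc
    (tfae_15_to_9 (tfae_10_to_15 (tfae_6_to_10 (tfae_2_to_6 (tfae_1_to_2 h)))))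
    (le_lawsonTop hsemi)).symm
  tfae_have 4 → 5 := fun h => h ▸ etaTop_le_iweakTop
  tfae_have 5 → 15 := fun h x y => exists_mem_interior_Ici_of_etaTop hsemi fun p hp => by
    obtain ⟨U, V, hUo, hU, hVo, hx, hy, hd⟩ := exists_isOpen_isUpperSet_disjoint hsemi hp
    exact ⟨U, V, h U (hU.isOpen_lawsonTop hsemi hUo), hVo, hx, hy, hd⟩
  tfae_finish
end
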